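/- arXiv:2207.04495 — 2 statements merged into one kernel-verified Lean document; each statement's English description precedes it below -/
import Mathlib

section
/- For every integer m ≥ 1, the ideal ker(φ(n,m)) of F(n,m) is generated by its homogeneous elements of degree at most 2n+2 (with respect to the grading deg ρ_α = 2, deg π_β = n). -/
open MvPolynomial

noncomputable section

/-- `ℂ[V^m]` for `V = ℂ²`: variable `(0, i)` is `xᵢ`, variable `(1, i)` is `yᵢ`. -/
abbrev PolyVm (m : ℕ) : Type := MvPolynomial (Fin 2 × Fin m) ℂ

/-- A `Finsupp` on `Fin m` built from a tuple. -/
def fsOf {m : ℕ} (v : Fin m → ℕ) : Fin m →₀ ℕ := Finsupp.equivFunOnFinite.symm v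

@[simp] lemma fsOf_apply {m : ℕ} (v : Fin m → ℕ) (i : Fin m) : fsOf v i = v i := rfl

lemma fsOf_sum2 (a b : ℕ) : ∑ i, fsOf ![a, b] i = a + b := by
  simp [Fin.sum_univ_two]

lemma fsOf_sum3 (a b c : ℕ) : ∑ i, fsOf ![a, b, c] i = a + b + c := by
  simp [Fin.sum_univ_three]

/-- The polarization `p_β = x^β + y^β` of `p = xⁿ + yⁿ`. -/
def pPoly {m : ℕ} (β : Fin m →₀ ℕ) : PolyVm m :=
  (∏ i, X (0, i) ^ β i) + (∏ i, X (1, i) ^ β i)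

/-- The polarization `q_α` of `q = xy` : `q_{2eᵢ} = xᵢyᵢ` and
`q_{eᵢ+eⱼ} = (xᵢyⱼ + xⱼyᵢ)/2` for `i ≠ j`. -/
def qPoly {m : ℕ} (α : Fin m →₀ ℕ) : PolyVm m :=
  ((((Finset.univ.filter fun ij : Fin m × Fin m =>
      Finsupp.single ij.1 1 + Finsupp.single ij.2 1 = α).card : ℕ) : ℂ))⁻¹ •
  ∑ ij ∈ Finset.univ.filter (fun ij : Fin m × Fin m =>
      Finsupp.single ij.1 1 + Finsupp.single ij.2 1 = α),
    X (0, ij.1) * X (1, ij.2)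

/-- Variables of the free symmetric algebra `F(n,m)`: `ρ_α` for `|α| = 2`
(left summand) and `π_β` for `|β| = n` (right summand). -/
abbrev FVar (n m : ℕ) : Type :=
  {d : Fin m →₀ ℕ // ∑ i, d i = 2} ⊕ {d : Fin m →₀ ℕ // ∑ i, d i = n}

/-- The polynomial algebra `F(n,m) = ℂ[ρ_α, π_β]`. -/
abbrev FAlg (n m : ℕ) : Type := MvPolynomial (FVar n m) ℂ

/-- The canonical surjection `φ(n,m) : F(n,m) → ℂ[V^m]^{D_{2n}} ⊆ ℂ[V^m]`,
`ρ_α ↦ q_α`, `π_β ↦ p_β`. -/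
def phi (n m : ℕ) : FAlg n m →ₐ[ℂ] PolyVm m :=
  aeval (Sum.elim (fun a => qPoly a.1) (fun b => pPoly b.1))

/-- The weights of the grading of `F(n,m)`: `deg ρ_α = 2`, `deg π_β = n`. -/
def wF (n m : ℕ) : FVar n m → ℕ := Sum.elim (fun _ => 2) (fun _ => n)

/-- The matrix `diag(ω, ω⁻¹)`. -/
def dMat (ω : ℂ) : Matrix (Fin 2) (Fin 2) ℂ := !![ω, 0; 0, ω⁻¹]

/-- The matrix `((0,1),(1,0))`. -/
def sMat : Matrix (Fin 2) (Fin 2) ℂ := !![0, 1; 1, 0]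

/-- The action of a `2×2` matrix `g` on `ℂ[V^m]` (diagonal action on the `m`
vector variables): `x_{a,i} ↦ ∑_b g_{a b} x_{b,i}`. -/
def actG {m : ℕ} (g : Matrix (Fin 2) (Fin 2) ℂ) : PolyVm m →ₐ[ℂ] PolyVm m :=
  aeval fun p => ∑ b : Fin 2, g p.1 b • X (b, p.2)

/-- The subalgebra of `ℂ[V^m]` of polynomials invariant under (the group
generated by) a set `S` of `2×2` matrices. -/
def invAlg (m : ℕ) (S : Set (Matrix (Fin 2) (Fin 2) ℂ)) : Subalgebra ℂ (PolyVm m) where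
  carrier := {f | ∀ g ∈ Submonoid.closure S, actG g f = f}
  mul_mem' := fun ha hb => by
    intro g hg
    rw [map_mul, ha g hg, hb g hg]
  add_mem' := fun ha hb => by
    intro g hg
    rw [map_add, ha g hg, hb g hg]
  algebraMap_mem' := fun c => by
    intro g hg
    exact (actG g).commutes c

/-- The invariant algebra `ℂ[V^m]^{D_{2n}}`, where `D_{2n}` is generated by
`diag(ω, ω⁻¹)` and `((0,1),(1,0))`. -/
def dihedralInv (m : ℕ) (ω : ℂ) : Subalgebra ℂ (PolyVm m) :=
  invAlg m {dMat ω, sMat}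

section Transfer

variable {ι B : Type*} [CommRing B]

/-- The multiset `β` placed in row `c` of the variables: for `c = 0` it encodes `x^β`, for `c = 1`
it encodes `y^β`. -/
def rowOf (c : Fin 2) (β : Multiset ι) : Multiset (Fin 2 × ι) := β.map (Prod.mk c)

lemma fin_two_add_one_add_one (c : Fin 2) : c + 1 + 1 = c := by
  fin_cases c <;> rfl

lemma rowOf_add (c : Fin 2) (β γ : Multiset ι) : rowOf c (β + γ) = rowOf c β + rowOf c γ :=
  Multiset.map_add _ _ _

lemma rowOf_cons (c : Fin 2) (i : ι) (β : Multiset ι) :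
    rowOf c (i ::ₘ β) = (c, i) ::ₘ rowOf c β :=
  Multiset.map_cons _ _ _

@[simp] lemma card_rowOf (c : Fin 2) (β : Multiset ι) : (rowOf c β).card = β.card :=
  Multiset.card_map _ _

lemma rowOf_injective (c : Fin 2) : Function.Injective (rowOf (ι := ι) c) :=
  Multiset.map_injective (Prod.mk_right_injective c)

lemma fst_of_mem_rowOf {c : Fin 2} {γ : Multiset ι} {z : Fin 2 × ι} (hz : z ∈ rowOf c γ) :
    z.1 = c := by
  obtain ⟨i, -, rfl⟩ := Multiset.mem_map.1 hz
  rfl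

lemma exists_eq_rowOf_add_rowOf (w : Multiset (Fin 2 × ι)) :
    ∃ a b, w = rowOf 0 a + rowOf 1 b := by
  induction w using Multiset.induction_on with
  | empty => exact ⟨0, 0, rfl⟩
  | cons z w ih =>
    obtain ⟨a, b, rfl⟩ := ih
    obtain ⟨c, i⟩ := z
    fin_cases c
    · exact ⟨i ::ₘ a, b, by simp [rowOf_cons]⟩
    · exact ⟨a, i ::ₘ b, by simp [rowOf_cons]⟩

/-- The encoding of the monomial `xᵢ xₗ yⱼ w` (for `c = 0`) or `yᵢ yₗ xⱼ w` (for `c = 1`). -/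
def tri (c : Fin 2) (i l j : ι) (w : Multiset (Fin 2 × ι)) : Multiset (Fin 2 × ι) :=
  (c, i) ::ₘ (c, l) ::ₘ (c + 1, j) ::ₘ w

@[simp] lemma card_tri (c : Fin 2) (i l j : ι) (w : Multiset (Fin 2 × ι)) :
    (tri c i l j w).card = w.card + 3 := by
  simp [tri]

lemma add_tri (v : Multiset (Fin 2 × ι)) (c : Fin 2) (i l j : ι) (w : Multiset (Fin 2 × ι)) :
    v + tri c i l j w = tri c i l j (v + w) := by
  simp [tri]

lemma tri_ne_rowOf (c : Fin 2) (i l j : ι) (w : Multiset (Fin 2 × ι)) (c' : Fin 2)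
    (γ : Multiset ι) : tri c i l j w ≠ rowOf c' γ := by
  intro h
  have h1 : (c, i) ∈ rowOf c' γ := by simp [← h, tri]
  have h2 : (c + 1, j) ∈ rowOf c' γ := by simp [← h, tri]
  have := (fst_of_mem_rowOf h1).trans (fst_of_mem_rowOf h2).symm
  revert this
  fin_cases c <;> simp

lemma exists_rowOf_add_rowOf_eq_tri (c : Fin 2) {a b : Multiset ι} (ha : 2 ≤ a.card)
    (hb : 1 ≤ b.card) :
    ∃ i l j w, rowOf c a + rowOf (c + 1) b = tri c i l j w := by
  obtain ⟨i, a, rfl⟩ := Multiset.card_pos_iff_exists_mem.1 (by omega : 0 < a.card) |>.imp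
    fun i hi => Multiset.exists_cons_of_mem hi
  rw [Multiset.card_cons] at ha
  obtain ⟨l, a, rfl⟩ := Multiset.card_pos_iff_exists_mem.1 (by omega : 0 < a.card) |>.imp
    fun i hi => Multiset.exists_cons_of_mem hi
  obtain ⟨j, b, rfl⟩ := Multiset.card_pos_iff_exists_mem.1 (by omega : 0 < b.card) |>.imp
    fun i hi => Multiset.exists_cons_of_mem hi
  refine ⟨i, l, j, rowOf c a + rowOf (c + 1) b, ?_⟩
  simp only [rowOf_cons, tri]
  simp only [← Multiset.singleton_add]
  abel

lemma exists_eq_tri_or_rowOf {w : Multiset (Fin 2 × ι)} (hw : 3 ≤ w.card) :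
    (∃ c i l j w', w = tri c i l j w') ∨ ∃ c γ, w = rowOf c γ := by
  obtain ⟨a, b, rfl⟩ := exists_eq_rowOf_add_rowOf w
  simp only [Multiset.card_add, card_rowOf] at hw
  rcases Nat.eq_zero_or_pos a.card with ha | ha
  · rw [Multiset.card_eq_zero] at ha
    exact .inr ⟨1, b, by simp [ha, rowOf]⟩
  rcases Nat.eq_zero_or_pos b.card with hb | hb
  · rw [Multiset.card_eq_zero] at hb
    exact .inr ⟨0, a, by simp [hb, rowOf]⟩
  left
  by_cases h : 2 ≤ a.card
  · obtain ⟨i, l, j, w', h'⟩ := exists_rowOf_add_rowOf_eq_tri 0 h hb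
    exact ⟨_, i, l, j, w', h'⟩
  · obtain ⟨i, l, j, w', h'⟩ := exists_rowOf_add_rowOf_eq_tri 1 (by omega : 2 ≤ b.card) ha
    exact ⟨_, i, l, j, w', by rw [add_comm]; exact h'⟩

lemma exists_eq_add_card_eq {γ : Multiset ι} {n : ℕ} (h : n ≤ γ.card) :
    ∃ β δ, γ = β + δ ∧ β.card = n := by
  induction n with
  | zero => exact ⟨0, γ, by simp, rfl⟩
  | succ n ih =>
    obtain ⟨β, δ, rfl, hβ⟩ := ih (by omega)
    rw [Multiset.card_add] at h
    obtain ⟨i, δ, rfl⟩ := Multiset.card_pos_iff_exists_mem.1 (by omega : 0 < δ.card) |>.imp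
      fun i hi => Multiset.exists_cons_of_mem hi
    exact ⟨i ::ₘ β, δ, by simp, by simp [hβ]⟩

/-- An expression attached to decompositions of a multiset of size greater than `2 n` into a part
of size `n` and the rest only depends on the multiset if it does not change
when the part is replaced by a disjoint one. -/
lemma eq_of_add_eq_add_of_exchange {α : Type*}
    {V : Multiset ι → Multiset ι → α} {n N : ℕ} (hN : 2 * n + 1 ≤ N)
    (h : ∀ β β' ε : Multiset ι, β.card = n → β'.card = n → β.card + β'.card + ε.card = N →
      V β (β' + ε) = V β' (β + ε))
    {β β' δ δ' : Multiset ι} (hβ : β.card = n) (hβ' : β'.card = n) (hδ : β.card + δ.card = N)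
    (e : β + δ = β' + δ') : V β δ = V β' δ' := by
  classical
  have swap : ∀ i j β₀ ε₀, (i ::ₘ β₀).card = n → (i ::ₘ β₀).card + (j ::ₘ ε₀).card = N →
      V (i ::ₘ β₀) (j ::ₘ ε₀) = V (j ::ₘ β₀) (i ::ₘ ε₀) := by
    intro i j β₀ ε₀ hβ hc
    simp only [Multiset.card_cons] at hβ hc
    obtain ⟨β₁, ε, rfl, hβ₁⟩ := exists_eq_add_card_eq (γ := ε₀) (n := n) (by omega)
    rw [Multiset.card_add] at hc
    have h1 := h (i ::ₘ β₀) β₁ (j ::ₘ ε) (by simpa using hβ) hβ₁ (by simp; omega)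
    have h2 := h (j ::ₘ β₀) β₁ (i ::ₘ ε) (by simpa using hβ) hβ₁ (by simp; omega)
    rw [Multiset.add_cons] at h1 h2
    rw [h1, h2]
    congr 1
    simp only [← Multiset.singleton_add]
    abel
  have main : ∀ (β' κ β δ δ' : Multiset ι), (κ + β).card = n → β.card = β'.card →
      (κ + β).card + δ.card = N → κ + β + δ = κ + β' + δ' → V (κ + β) δ = V (κ + β') δ' := by
    intro β'
    induction β' using Multiset.induction_on with
    | empty =>
      intro κ β δ δ' _ hc _ e
      obtain rfl : β = 0 := by simpa using hc
      rw [add_right_inj] at e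
      rw [e]
    | cons j β' ih =>
      intro κ β δ δ' hn' hc hN' e
      rw [Multiset.card_cons] at hc
      by_cases hj : j ∈ β
      · obtain ⟨β, rfl⟩ := Multiset.exists_cons_of_mem hj
        have := ih (j ::ₘ κ) β δ δ' (by simpa using hn') (by simpa using hc)
          (by simpa using hN') (by simpa using e)
        simpa using this
      · have hj' : j ∈ β + δ := by
          rw [add_assoc, add_assoc, add_right_inj] at e
          rw [e]
          simp
        have hj' : j ∈ δ := (Multiset.mem_add.1 hj').resolve_left hj
        obtain ⟨δ, rfl⟩ := Multiset.exists_cons_of_mem hj'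
        obtain ⟨i, β, rfl⟩ := Multiset.card_pos_iff_exists_mem.1 (by omega : 0 < β.card) |>.imp
          fun i hi => Multiset.exists_cons_of_mem hi
        have h1 := swap i j (κ + β) δ (by simpa using hn') (by simpa using hN')
        have h2 := ih (j ::ₘ κ) β (i ::ₘ δ) δ' (by simpa using hn') (by simpa using hc)
          (by simpa using hN') (by
            simp only [Multiset.add_cons, Multiset.cons_add] at e ⊢
            rw [Multiset.cons_swap, e])
        rw [Multiset.add_cons, h1]
        simpa using h2
  have := main β' 0 β δ δ' (by simpa using hβ) (by omega) (by simpa using hδ) (by simpa using e)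
  simpa using this

/-- `T`, defined on (encodings of) monomials, behaves up to degree `d` like a map that is linear
over an algebra in which `r i j` acts as `xᵢ yⱼ + xⱼ yᵢ` and `p β` acts as `x^β + y^β`. -/
structure IsTransferUpTo (r : ι → ι → B) (p : Multiset ι → B) (n d : ℕ)
    (T : Multiset (Fin 2 × ι) → B) : Prop where
  r_mul : ∀ i j w, w.card + 2 ≤ d →
    r i j * T w = T ((0, i) ::ₘ (1, j) ::ₘ w) + T ((0, j) ::ₘ (1, i) ::ₘ w)
  p_mul : ∀ β w, β.card = n → w.card + n ≤ d →
    p β * T w = T (rowOf 0 β + w) + T (rowOf 1 β + w)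

/-- The expansion of `2 T (xᵢ xₗ yⱼ w)` in terms of values of `T` in lower degree. -/
def triExp (r : ι → ι → B) (T : Multiset (Fin 2 × ι) → B) (c : Fin 2) (i l j : ι)
    (w : Multiset (Fin 2 × ι)) : B :=
  r i j * T ((c, l) ::ₘ w) + r l j * T ((c, i) ::ₘ w) - r i l * T ((c, j) ::ₘ w)

lemma triExp_comm {r : ι → ι → B} (hr : ∀ i j, r i j = r j i) (T : Multiset (Fin 2 × ι) → B)
    (c : Fin 2) (i l j : ι) (w : Multiset (Fin 2 × ι)) :
    triExp r T c i l j w = triExp r T c l i j w := by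
  simp only [triExp, hr l i]
  ring

/-- If the expansions of monomials of degree `k + 4` satisfy the two basic exchange rules, then
the expansion depends on the monomial only. -/
lemma triExp_eq_of_tri_eq {r : ι → ι → B} (hr : ∀ i j, r i j = r j i)
    {T : Multiset (Fin 2 × ι) → B} {k : ℕ}
    (h₁ : ∀ c i l s j w, w.card = k →
      triExp r T c i l j ((c, s) ::ₘ w) = triExp r T c i s j ((c, l) ::ₘ w))
    (h₂ : ∀ c i l s j w, w.card = k →
      triExp r T c i l j ((c + 1, s) ::ₘ w) = triExp r T (c + 1) j s i ((c, l) ::ₘ w))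
    {c i l j w c' i' l' j' w'} (hw : w.card = k + 1)
    (h : tri c i l j w = tri c' i' l' j' w') :
    triExp r T c i l j w = triExp r T c' i' l' j' w' := by
  classical
  have hk : ∀ {z : Fin 2 × ι} {u v}, u = z ::ₘ v → u.card = k + 1 → v.card = k := by
    rintro z u v rfl h; simpa using h
  -- one may replace the last variable `l` of row `c`
  have hl : ∀ c i l j w l', w.card = k + 1 → (c, l') ∈ (c, l) ::ₘ w →
      ∃ w', w'.card = k + 1 ∧ tri c i l j w = tri c i l' j w' ∧
        triExp r T c i l j w = triExp r T c i l' j w' := by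
    intro c i l j w l' hw hm
    rcases Multiset.mem_cons.1 hm with h | h
    · obtain rfl : l' = l := by simpa using h
      exact ⟨w, hw, rfl, rfl⟩
    · obtain ⟨v, rfl⟩ := Multiset.exists_cons_of_mem h
      have hv := hk rfl hw
      refine ⟨(c, l) ::ₘ v, by simp [hv], ?_, h₁ _ _ _ _ _ _ hv⟩
      simp only [tri, ← Multiset.singleton_add]
      abel
  -- one may replace the variable `j` of row `c + 1`
  have hj : ∀ c i l j w j', w.card = k + 1 → (c + 1, j') ∈ (c + 1, j) ::ₘ w →
      ∃ w', w'.card = k + 1 ∧ tri c i l j w = tri c i l j' w' ∧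
        triExp r T c i l j w = triExp r T c i l j' w' := by
    intro c i l j w j' hw hm
    rcases Multiset.mem_cons.1 hm with h | h
    · obtain rfl : j' = j := by simpa using h
      exact ⟨w, hw, rfl, rfl⟩
    · obtain ⟨v, rfl⟩ := Multiset.exists_cons_of_mem h
      have hv := hk rfl hw
      refine ⟨(c + 1, j) ::ₘ v, by simp [hv], ?_, ?_⟩
      · simp only [tri, ← Multiset.singleton_add]
        abel
      · rw [h₂ _ _ _ _ _ _ hv, triExp_comm hr, ← h₂ _ _ _ _ _ _ hv]
  have hcomm : ∀ c i l j (w : Multiset (Fin 2 × ι)), tri c i l j w = tri c l i j w := by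
    intro c i l j w
    simp only [tri, ← Multiset.singleton_add]
    abel
  have hne : ∀ c : Fin 2, c ≠ c + 1 := by decide
  -- one may replace the variable `i` of row `c`
  have hi : ∀ c i l j w i', w.card = k + 1 → (c, i') ∈ tri c i l j w →
      ∃ l' w', w'.card = k + 1 ∧ tri c i l j w = tri c i' l' j w' ∧
        triExp r T c i l j w = triExp r T c i' l' j w' := by
    intro c i l j w i' hw hm
    by_cases hii : i' = i
    · subst hii
      exact ⟨l, w, hw, rfl, rfl⟩
    · have hm' : (c, i') ∈ (c, l) ::ₘ w := by
        simp only [tri, Multiset.mem_cons, Prod.mk.injEq, hii, hne, and_false, false_and,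
          false_or, true_and] at hm
        simpa using hm
      obtain ⟨w', hw', e₁, e₂⟩ := hl c i l j w i' hw hm'
      exact ⟨i, w', hw', by rw [e₁, hcomm], by rw [e₂, triExp_comm hr]⟩
  -- one may replace `i` and `j` simultaneously
  have hij : ∀ c i l j w i' j', w.card = k + 1 → (c, i') ∈ tri c i l j w →
      (c + 1, j') ∈ tri c i l j w → ∃ l' w', w'.card = k + 1 ∧ tri c i l j w = tri c i' l' j' w' ∧
        triExp r T c i l j w = triExp r T c i' l' j' w' := by
    intro c i l j w i' j' hw hmi hmj
    obtain ⟨l', w', hw', e₁, e₂⟩ := hi c i l j w i' hw hmi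
    rw [e₁] at hmj
    have hm' : (c + 1, j') ∈ (c + 1, j) ::ₘ w' := by
      simpa only [tri, Multiset.mem_cons, Prod.mk.injEq, (hne c).symm, false_and,
        false_or] using hmj
    obtain ⟨w'', hw'', e₃, e₄⟩ := hj c i' l' j w' j' hw' hm'
    exact ⟨l', w'', hw'', e₁.trans e₃, e₂.trans e₄⟩
  have hc : ∀ c c' : Fin 2, c' = c ∨ c' = c + 1 := by decide
  rcases hc c c' with rfl | rfl
  · obtain ⟨l₁, w₁, hw₁, e₁, e₂⟩ := hij c' i l j w i' j' hw (by rw [h]; simp [tri])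
      (by rw [h]; simp [tri])
    rw [h] at e₁
    have e₃ : (c', l') ::ₘ w' = (c', l₁) ::ₘ w₁ := by
      have : ∀ l (w : Multiset (Fin 2 × ι)),
          tri c' i' l j' w = (c', i') ::ₘ (c' + 1, j') ::ₘ (c', l) ::ₘ w := by
        intro l w
        simp only [tri, ← Multiset.singleton_add]
        abel
      simpa [this] using e₁
    obtain ⟨w₂, -, e₄, e₅⟩ := hl c' i' l₁ j' w₁ l' hw₁ (by rw [← e₃]; simp)
    obtain rfl : w' = w₂ := by simpa [tri] using e₁.trans e₄
    rw [e₂, e₅]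
  · obtain ⟨l₁, w₁, hw₁, e₁, e₂⟩ := hij c i l j w j' i' hw
      (by rw [h]; simp [tri, fin_two_add_one_add_one]) (by rw [h]; simp [tri])
    rw [h] at e₁
    have e₃ : (c + 1, l') ::ₘ w' = (c, l₁) ::ₘ w₁ := by
      have h1 : tri (c + 1) i' l' j' w' =
          (c + 1, i') ::ₘ (c, j') ::ₘ (c + 1, l') ::ₘ w' := by
        simp only [tri, fin_two_add_one_add_one, ← Multiset.singleton_add]
        abel
      have h2 : tri c j' l₁ i' w₁ = (c + 1, i') ::ₘ (c, j') ::ₘ (c, l₁) ::ₘ w₁ := by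
        simp only [tri, ← Multiset.singleton_add]
        abel
      simpa [h1, h2] using e₁
    have hm : (c + 1, l') ∈ w₁ := by
      have : (c + 1, l') ∈ (c, l₁) ::ₘ w₁ := by rw [← e₃]; simp
      simpa [(hne c).symm] using this
    obtain ⟨v, rfl⟩ := Multiset.exists_cons_of_mem hm
    have hv := hk rfl hw₁
    obtain rfl : w' = (c, l₁) ::ₘ v := by
      rw [Multiset.cons_swap] at e₃
      simpa using e₃
    rw [e₂, h₂ _ _ _ _ _ _ hv]

namespace IsTransferUpTo

variable {r : ι → ι → B} {p : Multiset ι → B} {n d : ℕ} {T : Multiset (Fin 2 × ι) → B}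

lemma r_mul' (hT : IsTransferUpTo r p n d T) (c : Fin 2) (i j : ι) (w : Multiset (Fin 2 × ι))
    (hw : w.card + 2 ≤ d) :
    r i j * T w = T ((c, i) ::ₘ (c + 1, j) ::ₘ w) + T ((c, j) ::ₘ (c + 1, i) ::ₘ w) := by
  rw [hT.r_mul i j w hw]
  fin_cases c
  · rfl
  · rw [add_comm, Multiset.cons_swap, Multiset.cons_swap (0, i)]
    rfl

lemma p_mul' (hT : IsTransferUpTo r p n d T) (c : Fin 2) (β : Multiset ι)
    (w : Multiset (Fin 2 × ι)) (hβ : β.card = n) (hw : w.card + n ≤ d) :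
    p β * T w = T (rowOf c β + w) + T (rowOf (c + 1) β + w) := by
  rw [hT.p_mul β w hβ hw]
  fin_cases c
  · rfl
  · exact add_comm _ _

lemma triExp_eq (hT : IsTransferUpTo r p n d T) (c : Fin 2) (i l j : ι)
    (w : Multiset (Fin 2 × ι)) (hw : w.card + 3 ≤ d) :
    triExp r T c i l j w = 2 * T (tri c i l j w) := by
  rw [triExp, hT.r_mul' c i j _ (by simpa using hw), hT.r_mul' c l j _ (by simpa using hw),
    hT.r_mul' c i l _ (by simpa using hw)]
  have e₁ : (c, i) ::ₘ (c + 1, j) ::ₘ (c, l) ::ₘ w = tri c i l j w := by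
    simp only [tri, ← Multiset.singleton_add]; abel
  have e₂ : (c, l) ::ₘ (c + 1, j) ::ₘ (c, i) ::ₘ w = tri c i l j w := by
    simp only [tri, ← Multiset.singleton_add]; abel
  have e₃ : (c, j) ::ₘ (c + 1, i) ::ₘ (c, l) ::ₘ w = (c, l) ::ₘ (c + 1, i) ::ₘ (c, j) ::ₘ w := by
    simp only [← Multiset.singleton_add]; abel
  have e₄ : (c, j) ::ₘ (c + 1, l) ::ₘ (c, i) ::ₘ w = (c, i) ::ₘ (c + 1, l) ::ₘ (c, j) ::ₘ w := by
    simp only [← Multiset.singleton_add]; abel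
  rw [e₁, e₂, e₃, e₄]
  ring

variable [Invertible (2 : B)]

/-- A linear relation between values of `T`, stable under multiplication by monomials and valid up
to total degree `d`, is valid in total degree `d + 1`. -/
lemma sum_eq_zero (hT : IsTransferUpTo r p n d T) (hn : 3 ≤ n) (hd : 2 * n + 2 ≤ d) {κ : Type*}
    (S : Finset κ) (a : κ → B) (v : κ → Multiset (Fin 2 × ι)) (hv : ∀ k, (v k).card = 2)
    (h₀ : ∀ w, w.card + 4 ≤ d → ∑ k ∈ S, a k * T (v k + w) = 0)
    (w : Multiset (Fin 2 × ι)) (hw : w.card + 4 = d + 1) :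
    ∑ k ∈ S, a k * T (v k + w) = 0 := by
  have key : ∀ c i l j w, (tri c i l j w).card + 4 = d + 1 →
      ∑ k ∈ S, a k * T (v k + tri c i l j w) = 0 := by
    intro c i l j w hw
    rw [card_tri] at hw
    apply (isUnit_of_invertible (2 : B)).mul_left_cancel
    have h1 := h₀ ((c, l) ::ₘ w) (by rw [Multiset.card_cons]; omega)
    have h2 := h₀ ((c, i) ::ₘ w) (by rw [Multiset.card_cons]; omega)
    have h3 := h₀ ((c, j) ::ₘ w) (by rw [Multiset.card_cons]; omega)
    have : 2 * ∑ k ∈ S, a k * T (v k + tri c i l j w) =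
        r i j * ∑ k ∈ S, a k * T (v k + (c, l) ::ₘ w) +
        r l j * ∑ k ∈ S, a k * T (v k + (c, i) ::ₘ w) -
        r i l * ∑ k ∈ S, a k * T (v k + (c, j) ::ₘ w) := by
      simp only [Finset.mul_sum, ← Finset.sum_add_distrib, ← Finset.sum_sub_distrib]
      refine Finset.sum_congr rfl fun k _ => ?_
      have := hT.triExp_eq c i l j (v k + w) (by rw [Multiset.card_add, hv]; omega)
      rw [add_tri, mul_left_comm, ← this, triExp]
      simp only [Multiset.add_cons]
      ring
    rw [this, h1, h2, h3]
    ring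
  rcases exists_eq_tri_or_rowOf (w := w) (by omega) with ⟨c, i, l, j, w, rfl⟩ | ⟨c, γ, rfl⟩
  · exact key _ _ _ _ _ hw
  · rw [card_rowOf] at hw
    obtain ⟨β, δ, rfl, hβ⟩ := exists_eq_add_card_eq (γ := γ) (n := n) (by omega)
    rw [Multiset.card_add] at hw
    obtain ⟨i, l, j, w', hw'⟩ := exists_rowOf_add_rowOf_eq_tri (ι := ι) (c + 1) (a := β) (b := δ)
      (by omega) (by omega)
    rw [fin_two_add_one_add_one] at hw'
    have hc := congrArg Multiset.card hw'
    simp only [Multiset.card_add, card_rowOf] at hc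
    have h1 := key (c + 1) i l j w' (by omega)
    have h2 := h₀ (rowOf c δ) (by rw [card_rowOf]; omega)
    have : ∑ k ∈ S, a k * T (v k + rowOf c (β + δ)) =
        p β * ∑ k ∈ S, a k * T (v k + rowOf c δ) -
        ∑ k ∈ S, a k * T (v k + tri (c + 1) i l j w') := by
      simp only [Finset.mul_sum, ← Finset.sum_sub_distrib]
      refine Finset.sum_congr rfl fun k _ => ?_
      have := hT.p_mul' c β (v k + rowOf c δ) hβ
        (by rw [Multiset.card_add, hv, card_rowOf]; omega)
      rw [← hw', rowOf_add, mul_left_comm, this, add_left_comm (v k), add_left_comm (v k)]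
      ring
    rw [this, h1, h2]
    ring

/-- The values of an extension of `T` to degree `d + 1` on monomials involving both rows. -/
lemma exists_extension_tri (hr : ∀ i j, r i j = r j i) (hT : IsTransferUpTo r p n d T)
    (hn : 3 ≤ n) (hd : 2 * n + 2 ≤ d) :
    ∃ U : Multiset (Fin 2 × ι) → B, ∀ c i l j w, w.card + 3 = d + 1 →
      2 * U (tri c i l j w) = triExp r T c i l j w := by
  obtain ⟨k, rfl⟩ : ∃ k, d = k + 3 := ⟨d - 3, by omega⟩
  have pair (u v : Fin 2 × ι) : (({u, v} : Multiset (Fin 2 × ι))).card = 2 := rfl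
  have h₁ : ∀ c i l s j w, w.card = k →
      triExp r T c i l j ((c, s) ::ₘ w) = triExp r T c i s j ((c, l) ::ₘ w) := by
    intro c i l s j w hw
    have expand : ∀ w, triExp r T c i l j ((c, s) ::ₘ w) - triExp r T c i s j ((c, l) ::ₘ w) =
        ∑ k : Fin 4, ![r l j, - r i l, - r s j, r i s] k * T (![{(c, i), (c, s)},
          {(c, j), (c, s)}, {(c, i), (c, l)}, {(c, j), (c, l)}] k + w) := by
      intro w
      simp only [triExp, Fin.sum_univ_four, Matrix.cons_val, Multiset.insert_eq_cons,
        Multiset.cons_add, Multiset.singleton_add, Multiset.cons_swap (c, s) (c, l)]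
      ring
    rw [← sub_eq_zero, expand]
    refine hT.sum_eq_zero hn hd _ _ _ (fun k => by fin_cases k <;> rfl) (fun w hw => ?_) w
      (by omega)
    rw [← expand, hT.triExp_eq _ _ _ _ _ (by simp; omega),
      hT.triExp_eq _ _ _ _ _ (by simp; omega), ← mul_sub, sub_eq_zero.2, mul_zero]
    congr 1
    simp only [tri, ← Multiset.singleton_add]
    abel
  have h₂ : ∀ c i l s j w, w.card = k →
      triExp r T c i l j ((c + 1, s) ::ₘ w) = triExp r T (c + 1) j s i ((c, l) ::ₘ w) := by
    intro c i l s j w hw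
    have expand : ∀ w, triExp r T c i l j ((c + 1, s) ::ₘ w) -
        triExp r T (c + 1) j s i ((c, l) ::ₘ w) =
        ∑ k : Fin 6, ![r i j, r l j, - r i l, - r j i, - r s i, r j s] k *
          T (![{(c, l), (c + 1, s)}, {(c, i), (c + 1, s)}, {(c, j), (c + 1, s)},
            {(c + 1, s), (c, l)}, {(c + 1, j), (c, l)}, {(c + 1, i), (c, l)}] k + w) := by
      intro w
      simp only [triExp, Fin.sum_univ_six, Matrix.cons_val, Multiset.insert_eq_cons,
        Multiset.cons_add, Multiset.singleton_add]
      ring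
    rw [← sub_eq_zero, expand]
    refine hT.sum_eq_zero hn hd _ _ _ (fun k => by fin_cases k <;> rfl) (fun w hw => ?_) w
      (by omega)
    rw [← expand, hT.triExp_eq _ _ _ _ _ (by simp; omega),
      hT.triExp_eq _ _ _ _ _ (by simp; omega), ← mul_sub, sub_eq_zero.2, mul_zero]
    congr 1
    simp only [tri, fin_two_add_one_add_one]
    simp only [← Multiset.singleton_add]
    abel
  let X := {x : Fin 2 × ι × ι × ι × Multiset (Fin 2 × ι) // x.2.2.2.2.card = k + 1}
  let f : X → Multiset (Fin 2 × ι) := fun x => tri x.1.1 x.1.2.1 x.1.2.2.1 x.1.2.2.2.1 x.1.2.2.2.2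
  let g : X → B := fun x => ⅟2 * triExp r T x.1.1 x.1.2.1 x.1.2.2.1 x.1.2.2.2.1 x.1.2.2.2.2
  have hfg : Function.FactorsThrough g f := fun x y hxy => by
    simp only [g]
    rw [triExp_eq_of_tri_eq hr h₁ h₂ x.2 hxy]
  refine ⟨Function.extend f g 0, fun c i l j w hw => ?_⟩
  have := hfg.extend_apply 0 ⟨(c, i, l, j, w), by simp only; omega⟩
  simp only [f, g] at this
  rw [this, mul_invOf_cancel_left']

/-- A transfer up to degree `d ≥ 2 n + 2` extends to degree `d + 1`. -/
theorem extend (hr : ∀ i j, r i j = r j i) (hT : IsTransferUpTo r p n d T)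
    (hn : 3 ≤ n) (hd : 2 * n + 2 ≤ d) :
    ∃ T', IsTransferUpTo r p n (d + 1) T' ∧ T' 0 = T 0 := by
  classical
  obtain ⟨U, hU⟩ := hT.exists_extension_tri hr hn hd
  have hUp : ∀ c β w c' i l j w', β.card = n → w = tri c' i l j w' → w.card + n = d + 1 →
      p β * T w = U (rowOf c β + w) + U (rowOf (c + 1) β + w) := by
    rintro c β w c' i l j w' hβ rfl hw
    rw [card_tri] at hw
    apply (isUnit_of_invertible (2 : B)).mul_left_cancel
    rw [mul_add, add_tri, add_tri, hU _ _ _ _ _ (by simp; omega), hU _ _ _ _ _ (by simp; omega),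
      mul_left_comm, ← hT.triExp_eq _ _ _ _ _ (by omega)]
    have h1 := hT.p_mul' c β ((c', l) ::ₘ w') hβ (by simp; omega)
    have h2 := hT.p_mul' c β ((c', i) ::ₘ w') hβ (by simp; omega)
    have h3 := hT.p_mul' c β ((c', j) ::ₘ w') hβ (by simp; omega)
    simp only [Multiset.add_cons] at h1 h2 h3
    simp only [triExp]
    linear_combination r i j * h1 + r l j * h2 - r i l * h3
  let V : Fin 2 → Multiset ι → Multiset ι → B := fun c β δ =>
    p β * T (rowOf c δ) - U (rowOf (c + 1) β + rowOf c δ)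
  have hV : ∀ c (β β' δ δ' : Multiset ι), β.card = n → β'.card = n → β.card + δ.card = d + 1 →
      β + δ = β' + δ' → V c β δ = V c β' δ' := by
    intro c β β' δ δ' hβ hβ' hδ e
    refine eq_of_add_eq_add_of_exchange (n := n) (N := d + 1) (by omega) ?_ hβ hβ' hδ e
    intro β β' ε hβ hβ' hc
    have aux : ∀ β β' : Multiset ι, β.card = n → β'.card = n → β.card + β'.card + ε.card = d + 1 →
        V c β (β' + ε) = p β * p β' * T (rowOf c ε) - p β * T (rowOf (c + 1) β' + rowOf c ε)
          - p β' * T (rowOf (c + 1) β + rowOf c ε)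
          + U (rowOf (c + 1) β' + (rowOf (c + 1) β + rowOf c ε)) := by
      intro β β' hβ hβ' hc
      obtain ⟨i, l, j, w, hw⟩ := exists_rowOf_add_rowOf_eq_tri (ι := ι) (c + 1) (a := β) (b := ε)
        (by omega) (by omega)
      rw [fin_two_add_one_add_one] at hw
      have h1 := hUp c β' _ _ _ _ _ _ hβ' hw (by simp; omega)
      have h2 := hT.p_mul' c β' (rowOf c ε) hβ' (by simp; omega)
      simp only [V, rowOf_add]
      rw [add_left_comm]
      linear_combination (-p β) * h2 + h1
    rw [aux β β' hβ hβ' hc, aux β' β hβ' hβ (by omega), add_left_comm (rowOf (c + 1) β')]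
    ring
  let X := {x : Fin 2 × Multiset ι × Multiset ι // x.2.1.card = n ∧ x.2.1.card + x.2.2.card = d + 1}
  let f : X → Multiset (Fin 2 × ι) := fun x => rowOf x.1.1 (x.1.2.1 + x.1.2.2)
  let g : X → B := fun x => V x.1.1 x.1.2.1 x.1.2.2
  have hfg : Function.FactorsThrough g f := by
    rintro ⟨⟨c, β, δ⟩, hβ, hδ⟩ ⟨⟨c', β', δ'⟩, hβ', hδ'⟩ hxy
    simp only at hβ hδ hβ' hδ'
    simp only [f] at hxy
    have hc : c = c' := by
      obtain ⟨i, hi⟩ := Multiset.card_pos_iff_exists_mem.1 (by omega : 0 < β.card)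
      have h1 : (c, i) ∈ rowOf c (β + δ) :=
        Multiset.mem_map_of_mem _ (Multiset.mem_add.2 (.inl hi))
      rw [hxy] at h1
      exact fst_of_mem_rowOf h1
    subst hc
    exact hV c β β' δ δ' hβ hβ' hδ (rowOf_injective c hxy)
  let T' : Multiset (Fin 2 × ι) → B := fun m =>
    if m.card ≤ d then T m else if ∃ c γ, m = rowOf c γ then Function.extend f g 0 m else U m
  have hT'le : ∀ m, m.card ≤ d → T' m = T m := fun m hm => if_pos hm
  have hT'tri : ∀ c i l j w, (tri c i l j w).card = d + 1 →
      T' (tri c i l j w) = U (tri c i l j w) := by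
    intro c i l j w hm
    have : ¬ ∃ c' γ, tri c i l j w = rowOf c' γ := fun ⟨c', γ, h⟩ => tri_ne_rowOf _ _ _ _ _ _ _ h
    simp only [T', if_neg (by omega : ¬ (tri c i l j w).card ≤ d), if_neg this]
  have hT'row : ∀ c (β δ : Multiset ι), β.card = n → β.card + δ.card = d + 1 →
      T' (rowOf c (β + δ)) = V c β δ := by
    intro c β δ hβ hδ
    have h1 : ∃ c' γ, rowOf c (β + δ) = rowOf c' γ := ⟨c, _, rfl⟩
    have h2 : ¬ (rowOf c (β + δ)).card ≤ d := by simp; omega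
    simp only [T', if_neg h2, if_pos h1]
    exact hfg.extend_apply 0 ⟨(c, β, δ), hβ, hδ⟩
  refine ⟨T', ⟨?_, ?_⟩, hT'le 0 (by simp)⟩
  · intro i j w hw
    rcases Nat.lt_or_ge d (w.card + 2) with h | h
    · have hw' : w.card + 2 = d + 1 := by omega
      obtain ⟨⟨c, l⟩, hl⟩ := Multiset.card_pos_iff_exists_mem.1 (by omega : 0 < w.card)
      obtain ⟨w, rfl⟩ := Multiset.exists_cons_of_mem hl
      rw [Multiset.card_cons] at hw'
      have aux : ∀ i j, T' ((c, i) ::ₘ (c + 1, j) ::ₘ (c, l) ::ₘ w) = U (tri c i l j w) := by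
        intro i j
        rw [← hT'tri _ _ _ _ _ (by simp; omega)]
        congr 1
        simp only [tri, ← Multiset.singleton_add]
        abel
      have h1 : r i j * T' ((c, l) ::ₘ w) = T' ((c, i) ::ₘ (c + 1, j) ::ₘ (c, l) ::ₘ w) +
          T' ((c, j) ::ₘ (c + 1, i) ::ₘ (c, l) ::ₘ w) := by
        apply (isUnit_of_invertible (2 : B)).mul_left_cancel
        rw [aux, aux, mul_add, hU _ _ _ _ _ (by omega), hU _ _ _ _ _ (by omega),
          hT'le _ (by simp; omega)]
        simp only [triExp, hr j i, hr l i, hr l j]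
        ring
      rw [h1]
      obtain rfl | rfl : c = 0 ∨ c = 1 := by fin_cases c <;> simp
      · rfl
      · rw [add_comm, Multiset.cons_swap (1, j), Multiset.cons_swap (1, i)]
        rfl
    · rw [hT'le _ (by omega), hT'le _ (by simp; omega), hT'le _ (by simp; omega)]
      exact hT.r_mul i j w h
  · intro β w hβ hw
    rcases Nat.lt_or_ge d (w.card + n) with h | h
    · have hw' : w.card + n = d + 1 := by omega
      rw [hT'le w (by omega)]
      rcases exists_eq_tri_or_rowOf (w := w) (by omega) with ⟨c, i, l, j, w, rfl⟩ | ⟨c, γ, rfl⟩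
      · rw [card_tri] at hw'
        rw [hUp 0 β _ _ _ _ _ _ hβ rfl (by simp; omega), add_tri, add_tri, add_tri,
          hT'tri _ _ _ _ _ (by simp; omega), hT'tri _ _ _ _ _ (by simp; omega)]
        rfl
      · rw [card_rowOf] at hw'
        obtain ⟨i, l, j, w, hw₁⟩ := exists_rowOf_add_rowOf_eq_tri (ι := ι) (c + 1) (a := β) (b := γ)
          (by omega) (by omega)
        rw [fin_two_add_one_add_one] at hw₁
        have h1 := hT'row c β γ hβ (by omega)
        have h2 : T' (rowOf (c + 1) β + rowOf c γ) = U (rowOf (c + 1) β + rowOf c γ) := by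
          rw [hw₁]
          exact hT'tri _ _ _ _ _ (by rw [← hw₁]; simp; omega)
        have h3 : p β * T (rowOf c γ) =
            T' (rowOf c β + rowOf c γ) + T' (rowOf (c + 1) β + rowOf c γ) := by
          rw [← rowOf_add, h1, h2]
          simp only [V]
          ring
        rw [h3]
        fin_cases c
        · rfl
        · exact add_comm _ _
    · rw [hT'le _ (by omega), hT'le _ (by simp; omega), hT'le _ (by simp; omega)]
      exact hT.p_mul β w hβ h

theorem exists_of_le (hr : ∀ i j, r i j = r j i) (hT : IsTransferUpTo r p n (2 * n + 2) T)
    (hn : 3 ≤ n) (k : ℕ) :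
    ∃ T', IsTransferUpTo r p n (2 * n + 2 + k) T' ∧ T' 0 = T 0 := by
  induction k with
  | zero => exact ⟨T, hT, rfl⟩
  | succ k ih =>
    obtain ⟨T₁, h₁, e₁⟩ := ih
    obtain ⟨T₂, h₂, e₂⟩ := h₁.extend hr hn (by omega)
    exact ⟨T₂, h₂, e₂.trans e₁⟩

end IsTransferUpTo

end Transfer

section Dihedral

variable {m : ℕ}

/-- The monomial of `ℂ[V^m]` encoded by a multiset of variables. -/
def vmMon (w : Multiset (Fin 2 × Fin m)) : PolyVm m := monomial (Multiset.toFinsupp w) 1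

lemma vmMon_zero : vmMon (0 : Multiset (Fin 2 × Fin m)) = 1 := by
  simp [vmMon]

lemma vmMon_add (v w : Multiset (Fin 2 × Fin m)) : vmMon (v + w) = vmMon v * vmMon w := by
  simp [vmMon, monomial_mul]

lemma vmMon_singleton (z : Fin 2 × Fin m) : vmMon {z} = X z := by
  simp [vmMon, X]

lemma vmMon_cons (z : Fin 2 × Fin m) (w : Multiset (Fin 2 × Fin m)) :
    vmMon (z ::ₘ w) = X z * vmMon w := by
  rw [← Multiset.singleton_add, vmMon_add, vmMon_singleton]

lemma vmMon_rowOf (c : Fin 2) (β : Multiset (Fin m)) :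
    vmMon (rowOf c β) = ∏ i, X (c, i) ^ Multiset.toFinsupp β i := by
  induction β using Multiset.induction_on with
  | empty => simp [rowOf, vmMon_zero]
  | cons i β ih =>
    rw [rowOf_cons, vmMon_cons, ih]
    simp only [Multiset.toFinsupp_apply, Multiset.count_cons, pow_add, Finset.prod_mul_distrib,
      pow_ite, pow_one, pow_zero, Finset.prod_ite_eq', Finset.mem_univ,
      if_true]
    ring

lemma sum_toFinsupp (β : Multiset (Fin m)) : ∑ i, Multiset.toFinsupp β i = β.card := by
  rw [← Multiset.toFinsupp_sum_eq, Finsupp.sum_fintype _ _ (by simp)]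
  rfl

/-- The element `2 ρ_α` of `F(n,m)` for `α = eᵢ + eⱼ`. -/
def rhoF (n : ℕ) (i j : Fin m) : FAlg n m :=
  C 2 * X (.inl ⟨Finsupp.single i 1 + Finsupp.single j 1, by
    simp [Finset.sum_add_distrib]⟩)

/-- The element `π_β` of `F(n,m)` for `|β| = n`. -/
def piF (n : ℕ) (β : Multiset (Fin m)) : FAlg n m :=
  if h : β.card = n then X (.inr ⟨Multiset.toFinsupp β, (sum_toFinsupp β).trans h⟩) else 0

lemma rhoF_comm (n : ℕ) (i j : Fin m) : rhoF n i j = rhoF n j i := by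
  simp only [rhoF, add_comm]

lemma isWeightedHomogeneous_rhoF (n : ℕ) (i j : Fin m) :
    (rhoF n i j).IsWeightedHomogeneous (wF n m) 2 := by
  rw [rhoF, ← zero_add 2]
  exact (isWeightedHomogeneous_C _ _).mul (isWeightedHomogeneous_X ℂ (wF n m) _)

lemma isWeightedHomogeneous_piF (n : ℕ) (β : Multiset (Fin m)) :
    (piF n β).IsWeightedHomogeneous (wF n m) n := by
  unfold piF
  split_ifs with h
  · exact isWeightedHomogeneous_X ℂ (wF n m) _
  · exact isWeightedHomogeneous_zero _ _ _

lemma two_mul_qPoly (i j : Fin m) :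
    C 2 * qPoly (Finsupp.single i 1 + Finsupp.single j 1) =
      X (0, i) * X (1, j) + X (0, j) * X (1, i) := by
  have hf : Finset.univ.filter (fun ij : Fin m × Fin m =>
      Finsupp.single ij.1 1 + Finsupp.single ij.2 1 =
        (Finsupp.single i 1 + Finsupp.single j 1 : Fin m →₀ ℕ)) = {(i, j), (j, i)} := by
    ext ⟨a, b⟩
    simp [Finsupp.single_add_single_eq_single_add_single]
  rw [qPoly, hf, smul_eq_C_mul]
  by_cases hij : i = j
  · subst hij
    simp
    rw [map_ofNat]
    ring
  · have hne : (i, j) ≠ (j, i) := fun h => hij (congrArg Prod.fst h)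
    rw [Finset.card_pair hne, Finset.sum_pair hne, ← mul_assoc, ← C_mul]
    norm_num

lemma phi_rhoF (n : ℕ) (i j : Fin m) :
    phi n m (rhoF n i j) = X (0, i) * X (1, j) + X (0, j) * X (1, i) := by
  rw [rhoF, map_mul, ← two_mul_qPoly]
  simp [phi]

lemma phi_piF {n : ℕ} {β : Multiset (Fin m)} (h : β.card = n) :
    phi n m (piF n β) = vmMon (rowOf 0 β) + vmMon (rowOf 1 β) := by
  simp [piF, h, phi, pPoly, vmMon_rowOf]

/-- The weight modulo `n` of a monomial under `diag(ω, ω⁻¹)`. -/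
def vmWeight (n : ℕ) (w : Multiset (Fin 2 × Fin m)) : ZMod n :=
  (w.map fun z => if z.1 = 0 then 1 else -1).sum

/-- Twice the average over `D_{2n}` of the monomial encoded by `w`. -/
def vmTrace (n : ℕ) (w : Multiset (Fin 2 × Fin m)) : PolyVm m :=
  if vmWeight n w = 0 then vmMon w + vmMon (w.map fun z => (z.1 + 1, z.2)) else 0

lemma vmWeight_add (n : ℕ) (v w : Multiset (Fin 2 × Fin m)) :
    vmWeight n (v + w) = vmWeight n v + vmWeight n w := by
  simp [vmWeight]

lemma vmWeight_rowOf (n : ℕ) (c : Fin 2) (β : Multiset (Fin m)) :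
    vmWeight n (rowOf c β) = if c = 0 then (β.card : ZMod n) else -(β.card : ZMod n) := by
  fin_cases c <;> simp [vmWeight, rowOf]

lemma map_swap_rowOf (c : Fin 2) (β : Multiset (Fin m)) :
    (rowOf c β).map (fun z => (z.1 + 1, z.2)) = rowOf (c + 1) β := by
  simp [rowOf]

lemma isTransferUpTo_vmTrace (n d : ℕ) :
    IsTransferUpTo (fun i j => phi n m (rhoF n i j)) (fun β => phi n m (piF n β)) n d
      (vmTrace (m := m) n) where
  r_mul i j w _ := by
    have h : ∀ i j, vmWeight n ((0, i) ::ₘ (1, j) ::ₘ w) = vmWeight n w := by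
      simp [vmWeight]
    simp only [vmTrace, h, phi_rhoF]
    split_ifs
    · simp only [Multiset.map_cons, vmMon_cons, zero_add, (by decide : (1 : Fin 2) + 1 = 0)]
      ring
    · ring
  p_mul β w hβ _ := by
    have h : ∀ c, vmWeight n (rowOf c β + w) = vmWeight n w := by
      intro c
      rw [vmWeight_add, vmWeight_rowOf, hβ]
      simp
    simp only [vmTrace, h, phi_piF hβ]
    split_ifs
    · simp only [Multiset.map_add, map_swap_rowOf, vmMon_add, zero_add,
        (by decide : (1 : Fin 2) + 1 = 0)]
      ring
    · ring

/-- The trace of a monomial lifts to an element of `F(n,m)` of the same degree. -/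
lemma exists_phi_eq_vmTrace {n : ℕ} (hn : 3 ≤ n) (w : Multiset (Fin 2 × Fin m)) :
    ∃ f : FAlg n m, f.IsWeightedHomogeneous (wF n m) w.card ∧ phi n m f = vmTrace n w := by
  induction hk : w.card using Nat.strong_induction_on generalizing w with
  | _ k ih =>
  subst hk
  have htri : ∀ c i l j (w' : Multiset (Fin 2 × Fin m)), (tri c i l j w').card ≤ w.card →
      ∃ f : FAlg n m, f.IsWeightedHomogeneous (wF n m) (tri c i l j w').card ∧
        phi n m f = vmTrace n (tri c i l j w') := by
    intro c i l j w' hw'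
    rw [card_tri] at hw'
    obtain ⟨f₁, hf₁, e₁⟩ := ih _ (by simp; omega) ((c, l) ::ₘ w') rfl
    obtain ⟨f₂, hf₂, e₂⟩ := ih _ (by simp; omega) ((c, i) ::ₘ w') rfl
    obtain ⟨f₃, hf₃, e₃⟩ := ih _ (by simp; omega) ((c, j) ::ₘ w') rfl
    rw [Multiset.card_cons] at hf₁ hf₂ hf₃
    have hdeg : (tri c i l j w').card = 0 + (2 + (w'.card + 1)) := by
      rw [card_tri]
      omega
    refine ⟨C (1 / 2) * (rhoF n i j * f₁ + rhoF n l j * f₂ - rhoF n i l * f₃), ?_, ?_⟩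
    · rw [hdeg]
      refine (isWeightedHomogeneous_C _ _).mul ?_
      rw [← mem_weightedHomogeneousSubmodule]
      refine sub_mem (add_mem ?_ ?_) ?_
      · exact (isWeightedHomogeneous_rhoF n i j).mul hf₁
      · exact (isWeightedHomogeneous_rhoF n l j).mul hf₂
      · exact (isWeightedHomogeneous_rhoF n i l).mul hf₃
    · have := (isTransferUpTo_vmTrace (m := m) n (w'.card + 3)).triExp_eq c i l j w' le_rfl
      simp only [triExp] at this
      rw [map_mul, map_sub, map_add, map_mul, map_mul, map_mul, e₁, e₂, e₃, this, ← mul_assoc,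
        algHom_C, algebraMap_eq, ← map_ofNat (C : ℂ →+* PolyVm m) 2, ← C_mul]
      norm_num
  by_cases h₀ : vmWeight n w = 0
  swap
  · exact ⟨0, isWeightedHomogeneous_zero _ _ _, by simp [vmTrace, h₀]⟩
  have hrow : ∀ c γ, w = rowOf c γ →
      ∃ f : FAlg n m, f.IsWeightedHomogeneous (wF n m) w.card ∧ phi n m f = vmTrace n w := by
    rintro c γ rfl
    have hγ : (γ.card : ZMod n) = 0 := by
      rw [vmWeight_rowOf] at h₀
      split_ifs at h₀
      · exact h₀
      · exact neg_eq_zero.1 h₀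
    rw [ZMod.natCast_eq_zero_iff] at hγ
    rcases Nat.eq_zero_or_pos γ.card with h | h
    · obtain rfl : γ = 0 := by simpa using h
      refine ⟨C 2, by simpa using isWeightedHomogeneous_C _ _, ?_⟩
      simp only [rowOf, vmTrace, vmWeight, vmMon_zero, one_add_one_eq_two, algHom_C, algebraMap_eq,
        Multiset.map_zero, Multiset.sum_zero, if_true]
      exact map_ofNat C 2
    obtain ⟨β, δ, rfl, hβ⟩ := exists_eq_add_card_eq (Nat.le_of_dvd h hγ)
    rcases Nat.eq_zero_or_pos δ.card with hδ | hδ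
    · obtain rfl : δ = 0 := by simpa using hδ
      refine ⟨piF n β, by simpa [hβ] using isWeightedHomogeneous_piF n β, ?_⟩
      rw [phi_piF hβ, vmTrace, if_pos h₀, map_swap_rowOf, add_zero]
      fin_cases c
      · rfl
      · exact add_comm _ _
    obtain ⟨i, l, j, w', hw'⟩ := exists_rowOf_add_rowOf_eq_tri (ι := Fin m) (c + 1) (a := β)
      (b := δ) (by omega) hδ
    rw [fin_two_add_one_add_one] at hw'
    have hc := congrArg Multiset.card hw'
    simp only [Multiset.card_add, card_rowOf] at hc
    obtain ⟨f₁, hf₁, e₁⟩ := htri _ i l j w' (by rw [← hc]; simp)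
    obtain ⟨f₂, hf₂, e₂⟩ := ih _ (by simp; omega) (rowOf c δ) rfl
    refine ⟨piF n β * f₂ - f₁, ?_, ?_⟩
    · have hdeg : (rowOf c (β + δ)).card = n + (rowOf c δ).card := by simp [hβ]
      rw [← mem_weightedHomogeneousSubmodule]
      refine sub_mem ?_ ?_
      · rw [hdeg]
        exact (isWeightedHomogeneous_piF n β).mul hf₂
      · rw [← hc] at hf₁
        simpa using hf₁
    · have := (isTransferUpTo_vmTrace (m := m) n (δ.card + n)).p_mul' c β (rowOf c δ) hβ (by simp)
      rw [map_sub, map_mul, e₁, e₂, this, ← hw', rowOf_add]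
      ring
  rcases Nat.lt_or_ge w.card 3 with hw | hw
  swap
  · rcases exists_eq_tri_or_rowOf hw with ⟨c, i, l, j, w', rfl⟩ | ⟨c, γ, h⟩
    · exact htri _ _ _ _ _ le_rfl
    · exact hrow c γ h
  obtain ⟨a, b, rfl⟩ := exists_eq_rowOf_add_rowOf w
  simp only [Multiset.card_add, card_rowOf] at hw
  rcases Nat.eq_zero_or_pos a.card with ha | ha
  · exact hrow 1 b (by simp [Multiset.card_eq_zero.1 ha, rowOf])
  rcases Nat.eq_zero_or_pos b.card with hb | hb
  · exact hrow 0 a (by simp [Multiset.card_eq_zero.1 hb, rowOf])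
  obtain ⟨i, rfl⟩ := Multiset.card_eq_one.1 (by omega : a.card = 1)
  obtain ⟨j, rfl⟩ := Multiset.card_eq_one.1 (by omega : b.card = 1)
  refine ⟨rhoF n i j, isWeightedHomogeneous_rhoF n i j, ?_⟩
  rw [vmTrace, if_pos h₀, phi_rhoF]
  simp only [rowOf, Multiset.map_singleton, Multiset.map_add, vmMon_add, vmMon_singleton,
    zero_add, (by decide : (1 : Fin 2) + 1 = 0)]
  ring

section Quotient

variable {n : ℕ} {B : Type*} [CommRing B] [Algebra ℂ B]

/-- The linear extension to `ℂ[V^m]` of a function given on monomials. -/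
def vmLift (T : Multiset (Fin 2 × Fin m) → B) : PolyVm m →ₗ[ℂ] B :=
  (basisMonomials (Fin 2 × Fin m) ℂ).constr ℂ fun s => T (Finsupp.toMultiset s)

lemma vmLift_vmMon (T : Multiset (Fin 2 × Fin m) → B) (w : Multiset (Fin 2 × Fin m)) :
    vmLift T (vmMon w) = T w := by
  have := (basisMonomials (Fin 2 × Fin m) ℂ).constr_basis ℂ
    (fun s => T (Finsupp.toMultiset s)) (Multiset.toFinsupp w)
  rw [coe_basisMonomials, Multiset.toFinsupp_toMultiset] at this
  exact this

lemma eventually_vmLift_phi_mul (ψ : FAlg n m →ₐ[ℂ] B) (f : FAlg n m)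
    (w : Multiset (Fin 2 × Fin m)) :
    ∃ D, ∀ d ≥ D, ∀ T, IsTransferUpTo (fun i j => ψ (rhoF n i j)) (fun β => ψ (piF n β)) n d T →
      vmLift T (phi n m f * vmMon w) = ψ f * T w := by
  induction f using MvPolynomial.induction_on generalizing w with
  | C a =>
    refine ⟨0, fun d _ T _ => ?_⟩
    rw [algHom_C, algHom_C, ← Algebra.smul_def, map_smul, vmLift_vmMon, Algebra.smul_def]
  | add f g hf hg =>
    obtain ⟨D₁, h₁⟩ := hf w
    obtain ⟨D₂, h₂⟩ := hg w
    refine ⟨max D₁ D₂, fun d hd T hT => ?_⟩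
    rw [map_add, map_add, add_mul, add_mul, map_add, h₁ d (le_of_max_le_left hd) T hT,
      h₂ d (le_of_max_le_right hd) T hT]
  | mul_X f v hf =>
    rcases v with ⟨a, ha⟩ | ⟨b, hb⟩
    · obtain ⟨s, rfl⟩ := Multiset.toFinsupp.surjective a
      rw [sum_toFinsupp, Multiset.card_eq_two] at ha
      obtain ⟨i, j, rfl⟩ := ha
      have hX : (X (.inl ⟨Multiset.toFinsupp {i, j}, ha⟩) : FAlg n m) = C (1 / 2) * rhoF n i j := by
        have : (Multiset.toFinsupp {i, j} : Fin m →₀ ℕ) =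
            Finsupp.single i 1 + Finsupp.single j 1 := by
          rw [Multiset.insert_eq_cons, ← Multiset.singleton_add, map_add,
            Multiset.toFinsupp_singleton, Multiset.toFinsupp_singleton]
        simp only [rhoF, this, ← mul_assoc, ← C_mul]
        norm_num
      obtain ⟨D₁, h₁⟩ := hf ((0, i) ::ₘ (1, j) ::ₘ w)
      obtain ⟨D₂, h₂⟩ := hf ((0, j) ::ₘ (1, i) ::ₘ w)
      refine ⟨max (max D₁ D₂) (w.card + 2), fun d hd T hT => ?_⟩
      simp only [ge_iff_le, max_le_iff] at hd
      have e : phi n m (f * X (.inl ⟨Multiset.toFinsupp {i, j}, ha⟩)) * vmMon w =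
          (1 / 2 : ℂ) • (phi n m f * vmMon ((0, i) ::ₘ (1, j) ::ₘ w) +
            phi n m f * vmMon ((0, j) ::ₘ (1, i) ::ₘ w)) := by
        rw [hX, map_mul, map_mul, phi_rhoF, algHom_C, Algebra.smul_def]
        simp only [vmMon_cons]
        ring
      have hr := hT.r_mul i j w hd.2
      rw [e, map_smul, map_add, h₁ d hd.1.1 T hT, h₂ d hd.1.2 T hT, ← mul_add, ← hr, hX, map_mul,
        map_mul, algHom_C, Algebra.smul_def]
      ring
    · obtain ⟨β, rfl⟩ := Multiset.toFinsupp.surjective b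
      have hβ : β.card = n := by rwa [sum_toFinsupp] at hb
      have hX : (X (.inr ⟨Multiset.toFinsupp β, hb⟩) : FAlg n m) = piF n β := by
        simp [piF, hβ]
      obtain ⟨D₁, h₁⟩ := hf (rowOf 0 β + w)
      obtain ⟨D₂, h₂⟩ := hf (rowOf 1 β + w)
      refine ⟨max (max D₁ D₂) (w.card + n), fun d hd T hT => ?_⟩
      simp only [ge_iff_le, max_le_iff] at hd
      have e : phi n m (f * X (.inr ⟨Multiset.toFinsupp β, hb⟩)) * vmMon w =
          phi n m f * vmMon (rowOf 0 β + w) + phi n m f * vmMon (rowOf 1 β + w) := by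
        rw [hX, map_mul, phi_piF hβ]
        simp only [vmMon_add]
        ring
      have hp := hT.p_mul β w hβ hd.2
      rw [e, map_add, h₁ d hd.1.1 T hT, h₂ d hd.1.2 T hT, ← mul_add, ← hp, hX, map_mul]
      ring

end Quotient

end Dihedral

/-- The ideal of relations `ker φ(n,m)` is generated by its homogeneous elements of
degree at most `2n+2`, where `F(n,m)` is graded by `deg ρ_α = 2`, `deg π_β = n`. -/
theorem ker_phi_generated_in_degree_le_two_n_add_two
    (n : ℕ) (hn : 3 ≤ n) (ω : ℂ) (hω : IsPrimitiveRoot ω n) (m : ℕ) (hm : 1 ≤ m) :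
    RingHom.ker (phi n m) =
      Ideal.span {f : FAlg n m | f ∈ RingHom.ker (phi n m) ∧
        ∃ d ≤ 2 * n + 2, f.IsWeightedHomogeneous (wF n m) d} := by
  set J := Ideal.span {f : FAlg n m | f ∈ RingHom.ker (phi n m) ∧
        ∃ d ≤ 2 * n + 2, f.IsWeightedHomogeneous (wF n m) d} with hJ
  refine le_antisymm (fun f hf => ?_) (Ideal.span_le.2 fun f hf => hf.1)
  let ψ : FAlg n m →ₐ[ℂ] FAlg n m ⧸ J := Ideal.Quotient.mkₐ ℂ J
  have hψ : ∀ {f : FAlg n m} {d : ℕ}, f.IsWeightedHomogeneous (wF n m) d → d ≤ 2 * n + 2 →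
      phi n m f = 0 → ψ f = 0 := fun {f d} hd hle h0 =>
    Ideal.Quotient.eq_zero_iff_mem.2 (Ideal.subset_span ⟨h0, d, hle, hd⟩)
  have hunit : IsUnit (2 : FAlg n m ⧸ J) := by
    have h : IsUnit (algebraMap ℂ (FAlg n m ⧸ J) 2) := (IsUnit.mk0 (2 : ℂ) two_ne_zero).map _
    rwa [map_ofNat] at h
  let _ : Invertible (2 : FAlg n m ⧸ J) := hunit.invertible
  choose L hLdeg hL using fun w => exists_phi_eq_vmTrace (m := m) hn w
  have hcard : ∀ (w : Multiset (Fin 2 × Fin m)) y z, (y ::ₘ z ::ₘ w).card = 2 + w.card := by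
    intro w y z
    rw [Multiset.card_cons, Multiset.card_cons]
    omega
  have hbase : IsTransferUpTo (fun i j => ψ (rhoF n i j)) (fun β => ψ (piF n β)) n (2 * n + 2)
      (fun w => ψ (L w)) := by
    refine ⟨fun i j w hw => ?_, fun β w hβ hw => ?_⟩
    · rw [← map_mul, ← map_add, ← sub_eq_zero, ← map_sub]
      refine hψ (d := 2 + w.card) ?_ (by omega) ?_
      · rw [← mem_weightedHomogeneousSubmodule]
        refine sub_mem ?_ (add_mem ?_ ?_)
        · exact (isWeightedHomogeneous_rhoF n i j).mul (hLdeg w)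
        · exact hcard w (0, i) (1, j) ▸ hLdeg ((0, i) ::ₘ (1, j) ::ₘ w)
        · exact hcard w (0, j) (1, i) ▸ hLdeg ((0, j) ::ₘ (1, i) ::ₘ w)
      · rw [map_sub, map_mul, map_add, hL, hL, hL, sub_eq_zero]
        exact (isTransferUpTo_vmTrace n _).r_mul i j w hw
    · rw [← map_mul, ← map_add, ← sub_eq_zero, ← map_sub]
      refine hψ (d := n + w.card) ?_ (by omega) ?_
      · rw [← mem_weightedHomogeneousSubmodule]
        refine sub_mem ?_ (add_mem ?_ ?_)
        · exact (isWeightedHomogeneous_piF n β).mul (hLdeg w)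
        · simpa [hβ] using hLdeg (rowOf 0 β + w)
        · simpa [hβ] using hLdeg (rowOf 1 β + w)
      · rw [map_sub, map_mul, map_add, hL, hL, hL, sub_eq_zero]
        exact (isTransferUpTo_vmTrace n _).p_mul β w hβ hw
  have hL0 : ψ (L 0) = 2 := by
    rw [← map_ofNat ψ 2, ← sub_eq_zero, ← map_sub]
    refine hψ (d := 0) ?_ (by omega) ?_
    · rw [← mem_weightedHomogeneousSubmodule]
      refine sub_mem (by simpa using hLdeg 0) ?_
      exact isWeightedHomogeneous_C (wF n m) (2 : ℂ)
    · rw [map_sub, hL, map_ofNat]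
      simp [vmTrace, vmWeight, vmMon_zero, one_add_one_eq_two]
  obtain ⟨D, hD⟩ := eventually_vmLift_phi_mul ψ f 0
  obtain ⟨T, hT, hT0⟩ := hbase.exists_of_le (fun i j => by rw [rhoF_comm]) hn D
  have h := hD _ (by omega) T hT
  rw [RingHom.mem_ker] at hf
  rw [hf, zero_mul, map_zero, hT0, hL0] at h
  exact Ideal.Quotient.eq_zero_iff_mem.1 ((hunit.mul_left_eq_zero).1 h.symm)

end
end

section
/- There exists a finite set L of multihomogeneous elements of ℂ[V^m]^G, each of whose multidegrees is a weakly decreasing sequence, such that, for each f ∈ L choosing a set of left coset representatives in S_m of the stabilizer of the multidegree of f, the family {s·f : f ∈ L, s among the chosen coset representatives} is a basis of ℂ[V^m]^G as a free P(m)-module (in particular ℂ[V^m]^G is a free P(m)-module with such a basis). -/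
open MvPolynomial

noncomputable section

/-- `ℂ[V^m]` for `V = ℂ^k`: variable `(a, j)` is the `a`-th coordinate of the `j`-th
vector variable. -/
abbrev PolyVkm (k m : ℕ) : Type := MvPolynomial (Fin k × Fin m) ℂ

/-- Substitution action of a `k×k` matrix on `ℂ[V]`. -/
def actVk {k : ℕ} (g : Matrix (Fin k) (Fin k) ℂ) :
    MvPolynomial (Fin k) ℂ →ₐ[ℂ] MvPolynomial (Fin k) ℂ :=
  aeval fun a => ∑ b, g a b • X b

/-- Diagonal substitution action of a `k×k` matrix on `ℂ[V^m]`. -/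
def actVkm {k m : ℕ} (g : Matrix (Fin k) (Fin k) ℂ) : PolyVkm k m →ₐ[ℂ] PolyVkm k m :=
  aeval fun p => ∑ b, g p.1 b • X (b, p.2)

/-- The invariant algebra `ℂ[V]^G` for a subgroup `G ⊆ GL(V)`. -/
def invV (k : ℕ) (G : Subgroup (GL (Fin k) ℂ)) : Subalgebra ℂ (MvPolynomial (Fin k) ℂ) where
  carrier := {f | ∀ g ∈ G, actVk (g : Matrix (Fin k) (Fin k) ℂ) f = f}
  mul_mem' := fun ha hb => by
    intro g hg
    rw [map_mul, ha g hg, hb g hg]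
  add_mem' := fun ha hb => by
    intro g hg
    rw [map_add, ha g hg, hb g hg]
  algebraMap_mem' := fun c => by
    intro g hg
    exact (actVk _).commutes c

/-- The algebra of vector invariants `ℂ[V^m]^G` for a subgroup `G ⊆ GL(V)` acting
diagonally on `V^m`. -/
def invVm (k m : ℕ) (G : Subgroup (GL (Fin k) ℂ)) : Subalgebra ℂ (PolyVkm k m) where
  carrier := {f | ∀ g ∈ G, actVkm (g : Matrix (Fin k) (Fin k) ℂ) f = f}
  mul_mem' := fun ha hb => by
    intro g hg
    rw [map_mul, ha g hg, hb g hg]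
  add_mem' := fun ha hb => by
    intro g hg
    rw [map_add, ha g hg, hb g hg]
  algebraMap_mem' := fun c => by
    intro g hg
    exact (actVkm _).commutes c

/-- The action of `s ∈ S_m` on `ℂ[V^m]` permuting the `m` vector variables. -/
def permActk {k m : ℕ} (s : Equiv.Perm (Fin m)) : PolyVkm k m →ₐ[ℂ] PolyVkm k m :=
  rename fun p => (p.1, s p.2)

/-- `f` is multihomogeneous of multidegree `α ∈ ℕ^m`. -/
def IsMultiHomog {k m : ℕ} (f : PolyVkm k m) (α : Fin m → ℕ) : Prop :=
  ∀ d ∈ f.support, ∀ j : Fin m, (∑ a : Fin k, d (a, j)) = α j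

/-- The stabilizer of a multidegree `α` in `S_m`. -/
def mStab {m : ℕ} (α : Fin m → ℕ) : Set (Equiv.Perm (Fin m)) :=
  {s | ∀ j, α (s j) = α j}

/-- `C` is a set of left coset representatives of the stabilizer of `α` in `S_m`. -/
def IsCosetReps {m : ℕ} (α : Fin m → ℕ) (C : Set (Equiv.Perm (Fin m))) : Prop :=
  ∀ t : Equiv.Perm (Fin m), ∃! s, s ∈ C ∧ s⁻¹ * t ∈ mStab α

/-- The subalgebra `P(m) = ℂ[p_i^{(j)}] ⊆ ℂ[V^m]^G` generated by the copies of the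
`p_i` evaluated on the separate vector variables. -/
def Pm (k m : ℕ) (p : Fin k → MvPolynomial (Fin k) ℂ) : Subalgebra ℂ (PolyVkm k m) :=
  Algebra.adjoin ℂ
    {f | ∃ (i : Fin k) (j : Fin m), f = rename (fun a : Fin k => ((a, j) : Fin k × Fin m)) (p i)}

open RingTheory.Sequence in
/-- Generic linear combinations of a system of parameters replace a regular sequence one term at
a time. -/
theorem exists_linearIndependent_isWeaklyRegular {F S : Type*} [Field F] [Infinite F]
    [CommRing S] [IsLocalRing S] [IsNoetherianRing S] [Algebra F S] {ι : Type*} [Fintype ι]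
    (p : ι → S) (hp : ∀ i, p i ∈ IsLocalRing.maximalIdeal S)
    (f : List S) (hlen : f.length = Fintype.card ι) (hf : IsWeaklyRegular S f)
    (hfm : ∀ x ∈ f, x ∈ IsLocalRing.maximalIdeal S)
    (hrad : ∀ P : Ideal S, P.IsPrime → (∀ i, p i ∈ P) → ∀ x ∈ f, x ∈ P)
    (j : ℕ) (hj : j ≤ f.length) :
    ∃ c : Fin j → ι → F, LinearIndependent F c ∧
      IsWeaklyRegular S (List.ofFn (fun i => ∑ s, c i s • p s) ++ f.take (f.length - j)) := by
  induction j with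
  | zero =>
    exact ⟨Fin.elim0, linearIndependent_empty_type, by simpa using hf⟩
  | succ j ih =>
    obtain ⟨c, hc, hreg⟩ := ih (by omega)
    obtain ⟨r, hr⟩ : ∃ r, f.length - j = r + 1 := ⟨f.length - j - 1, by omega⟩
    have hr' : f.length - (j + 1) = r := by omega
    have hrl : r < f.length := by omega
    rw [hr']
    rw [hr, ← List.take_append_getElem hrl, ← List.append_assoc,
      isWeaklyRegular_append_iff, isWeaklyRegular_singleton_iff] at hreg
    obtain ⟨hreg1, hreg2⟩ := hreg
    set Q := List.ofFn (fun i => ∑ s, c i s • p s) with hQ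
    set M := S ⧸ (Ideal.ofList (Q ++ f.take r) • ⊤ : Submodule S S) with hM
    let φ : (ι → F) →ₗ[F] S :=
      ∑ s, (LinearMap.toSpanSingleton F S (p s)).comp (LinearMap.proj s)
    have hφ : ∀ c, φ c = ∑ s, c s • p s := by
      intro c
      simp [φ, LinearMap.sum_apply]
    let K : Option (associatedPrimes S M) → Subspace F (ι → F) := fun o =>
      o.elim (Submodule.span F (Set.range c))
        (fun P => (P.1.restrictScalars F).comap φ)
    have hfin : Finite (associatedPrimes S M) := (associatedPrimes.finite S M).to_subtype
    obtain ⟨x, hx⟩ : ∃ x : ι → F, ∀ o, x ∉ K o := by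
      by_contra! hcon
      obtain ⟨o, ho⟩ := Subspace.exists_eq_top_of_iUnion_eq_univ (p := K)
        (Set.eq_univ_of_forall fun x => by
          obtain ⟨o, ho⟩ := hcon x
          exact Set.mem_iUnion.2 ⟨o, ho⟩)
      rcases o with _ | P
      · have h1 := finrank_range_le_card (R := F) c
        have h2 : Module.finrank F (Submodule.span F (Set.range c)) = Fintype.card ι := by
          have : Submodule.span F (Set.range c) = ⊤ := ho
          rw [this, finrank_top, Module.finrank_fintype_fun_eq_card]
        rw [Set.finrank, h2, Fintype.card_fin] at h1
        omega
      · classical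
        have hP : P.1.IsPrime := P.2.1
        have h1 : ∀ i, p i ∈ P.1 := by
          intro i
          have : Pi.single i 1 ∈ K (some P) := by rw [ho]; trivial
          have h2 : φ (Pi.single i 1) ∈ P.1 := this
          rw [hφ] at h2
          simpa [Pi.single_apply, ite_smul] using h2
        have h2 := hrad P.1 hP h1 f[r] (List.getElem_mem hrl)
        have h3 : f[r] ∈ ⋃ p ∈ associatedPrimes S M, (p : Set S) :=
          Set.mem_biUnion P.2 h2
        rw [biUnion_associatedPrimes_eq_compl_regular] at h3
        exact h3 hreg2
    have hxreg : IsSMulRegular M (∑ s, x s • p s) := by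
      by_contra hcon
      have h3 : (∑ s, x s • p s) ∈ ⋃ p ∈ associatedPrimes S M, (p : Set S) := by
        rw [biUnion_associatedPrimes_eq_compl_regular]; exact hcon
      simp only [Set.mem_iUnion] at h3
      obtain ⟨P, hP, h4⟩ := h3
      exact hx (some ⟨P, hP⟩) (by
        change φ x ∈ P
        rw [hφ]; exact h4)
    refine ⟨Fin.cons x c, linearIndependent_finCons.2 ⟨hc, hx none⟩, ?_⟩
    have h5 : IsWeaklyRegular S ((Q ++ f.take r) ++ [∑ s, x s • p s]) := by
      rw [isWeaklyRegular_append_iff, isWeaklyRegular_singleton_iff]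
      exact ⟨hreg1, hxreg⟩
    have h6 : List.ofFn (fun i => ∑ s, (Fin.cons x c : Fin (j+1) → ι → F) i s • p s)
        = (∑ s, x s • p s) :: Q := by
      rw [List.ofFn_succ]; simp [hQ]
    rw [h6]
    have hlin : ∀ y : ι → F, (∑ s, y s • p s) ∈ IsLocalRing.maximalIdeal S := fun y =>
      Ideal.sum_mem _ fun s _ => by
        rw [Algebra.smul_def]; exact Ideal.mul_mem_left _ _ (hp s)
    refine IsLocalRing.isWeaklyRegular_of_perm_of_subset_maximalIdeal h5 ?_ ?_
    · rw [List.cons_append]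
      exact List.perm_append_singleton _ _
    · intro y hy
      simp only [List.mem_append, List.mem_singleton, hQ, List.mem_ofFn] at hy
      rcases hy with (⟨i, rfl⟩ | hy) | rfl
      · exact hlin _
      · exact hfm _ (List.mem_of_mem_take hy)
      · exact hlin _

open scoped Pointwise in
theorem eq_zero_of_sum_eval₂_smul_eq_zero {T R M κ : Type*} [CommRing T] [CommRing R]
    [AddCommGroup M] [Module R M] (φ : T →+* R) (q : R) (hq : IsSMulRegular M q) (w : κ → M)
    (s : Finset κ)
    (hw : ∀ a : κ → T, (∑ i ∈ s, φ (a i) • w i) ∈ (q • ⊤ : Submodule R M) → ∀ i ∈ s, a i = 0)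
    (a : κ → Polynomial T) (ha : ∑ i ∈ s, (a i).eval₂ φ q • w i = 0) : ∀ i ∈ s, a i = 0 := by
  suffices H : ∀ (D : ℕ) (a : κ → Polynomial T), (∀ i ∈ s, (a i).natDegree < D) →
      ∑ i ∈ s, (a i).eval₂ φ q • w i = 0 → ∀ i ∈ s, a i = 0 from
    H (s.sup (fun i => (a i).natDegree) + 1) a
      (fun i hi => Nat.lt_succ_of_le (Finset.le_sup (f := fun i => (a i).natDegree) hi)) ha
  intro D
  induction D with
  | zero => exact fun a hD _ i hi => absurd (hD i hi) (Nat.not_lt_zero _)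
  | succ D ih =>
    intro a hD ha
    have hsplit : ∀ i, (a i).eval₂ φ q = q * (a i).divX.eval₂ φ q + φ ((a i).coeff 0) := by
      intro i
      conv_lhs => rw [← Polynomial.X_mul_divX_add (a i), Polynomial.eval₂_add, Polynomial.eval₂_mul,
        Polynomial.eval₂_X, Polynomial.eval₂_C]
    have hsum : q • (∑ i ∈ s, (a i).divX.eval₂ φ q • w i) +
        ∑ i ∈ s, φ ((a i).coeff 0) • w i = 0 := by
      rw [← ha, Finset.smul_sum, ← Finset.sum_add_distrib]
      refine Finset.sum_congr rfl fun i _ => ?_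
      rw [hsplit, add_smul, mul_smul]
    have h0 : ∀ i ∈ s, (a i).coeff 0 = 0 := by
      refine hw _ ?_
      rw [eq_neg_of_add_eq_zero_right hsum]
      exact Submodule.neg_mem _ (Submodule.smul_mem_pointwise_smul _ _ _ trivial)
    have h1 : ∑ i ∈ s, (a i).divX.eval₂ φ q • w i = 0 := by
      rw [Finset.sum_eq_zero (s := s) (f := fun i => φ ((a i).coeff 0) • w i), add_zero] at hsum
      · exact hq (by simpa using hsum)
      · intro i hi; simp [h0 i hi]
    have hX : ∀ i ∈ s, a i = Polynomial.X * (a i).divX := by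
      intro i hi
      conv_lhs => rw [← Polynomial.X_mul_divX_add (a i), h0 i hi, map_zero, add_zero]
    by_cases hD0 : D = 0
    · subst hD0
      intro i hi
      rw [Polynomial.eq_C_of_natDegree_eq_zero (Nat.lt_one_iff.1 (hD i hi)), h0 i hi, map_zero]
    · have h2 := ih (fun i => (a i).divX) (fun i hi => by
        have := hD i hi
        rw [Polynomial.natDegree_divX_eq_natDegree_tsub_one]
        omega) h1
      intro i hi
      rw [hX i hi, h2 i hi, mul_zero]

open scoped Pointwise in
open RingTheory.Sequence in
theorem RingTheory.Sequence.IsWeaklyRegular.eq_zero_of_sum_aeval_smul_eq_zero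
    {F R κ : Type*} [Field F] [CommRing R]
    [Algebra F R] {n : ℕ} (q : Fin n → R) {M : Type*} [AddCommGroup M] [Module R M]
    (hq : IsWeaklyRegular M (List.ofFn q)) (w : κ → M) (s : Finset κ)
    (hw : ∀ a : κ → F, (∑ i ∈ s, algebraMap F R (a i) • w i) ∈
      (Ideal.ofList (List.ofFn q) • ⊤ : Submodule R M) → ∀ i ∈ s, a i = 0)
    (a : κ → MvPolynomial (Fin n) F) (ha : ∑ i ∈ s, aeval q (a i) • w i = 0) :
    ∀ i ∈ s, a i = 0 := by
  induction n generalizing M with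
  | zero =>
    have hC : ∀ i, a i = C ((a i).coeff 0) := fun i => eq_C_of_isEmpty _
    intro i hi
    rw [hC i, hw (fun i => (a i).coeff 0) ?_ i hi, C_0]
    convert Submodule.zero_mem _
    rw [← ha]
    refine Finset.sum_congr rfl fun i _ => ?_
    conv_rhs => rw [hC i, ← algebraMap_eq, AlgHom.commutes]
  | succ n ih =>
    rw [List.ofFn_succ, isWeaklyRegular_cons_iff] at hq
    have key := eq_zero_of_sum_eval₂_smul_eq_zero
      (aeval (R := F) (fun i => q (Fin.succ i))).toRingHom (q 0) hq.1 w s ?_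
      (fun i => finSuccEquiv F n (a i)) ?_
    · intro i hi
      exact (finSuccEquiv F n).map_eq_zero_iff.1 (key i hi)
    · intro b hb
      refine ih (M := QuotSMulTop (q 0) M) (fun i => q (Fin.succ i)) hq.2
        (fun i => Submodule.Quotient.mk (w i)) ?_ b ?_
      · intro c hc
        refine hw c ?_
        rw [List.ofFn_succ, Ideal.ofList_cons_smul]
        have h1 : (⊤ : Submodule R (QuotSMulTop (q 0) M)) = Submodule.map (Submodule.mkQ _) ⊤ := by
          rw [Submodule.map_top, Submodule.range_mkQ]
        rw [h1, ← Submodule.map_smul''] at hc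
        obtain ⟨y, hy, hyc⟩ := hc
        rw [show (∑ i ∈ s, algebraMap F R (c i) • w i) =
          ((∑ i ∈ s, algebraMap F R (c i) • w i) - y) + y by abel]
        refine Submodule.add_mem_sup ?_ hy
        rw [← Submodule.Quotient.mk_eq_zero, Submodule.Quotient.mk_sub, sub_eq_zero]
        change Submodule.mkQ _ _ = Submodule.mkQ _ _
        rw [hyc]
        simp
      · have h2 := (Submodule.Quotient.mk_eq_zero (q 0 • ⊤ : Submodule R M)).2 hb
        rw [← Submodule.mkQ_apply, map_sum] at h2
        simpa using h2
    · rw [← ha]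
      refine Finset.sum_congr rfl fun i _ => ?_
      congr 1
      have : (Polynomial.eval₂RingHom (aeval (R := F) (fun i => q (Fin.succ i))).toRingHom
          (q 0)).comp
          (finSuccEquiv F n).toAlgHom.toRingHom = (aeval (R := F) q).toRingHom := by
        apply MvPolynomial.ringHom_ext
        · intro r
          simp [finSuccEquiv_apply]
        · intro i
          refine Fin.cases ?_ (fun i => ?_) i <;> simp [finSuccEquiv_apply]
      exact congrArg (fun f => f (a i)) this

open RingTheory.Sequence in
theorem MvPolynomial.isWeaklyRegular_map_X {F σ : Type*} [Field F] (l : List σ) (hl : l.Nodup) :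
    IsWeaklyRegular (MvPolynomial σ F) (l.map (X : σ → MvPolynomial σ F)) := by
  induction l using List.reverseRecOn with
  | nil => exact .nil _ _
  | append_singleton l t ih =>
    rw [List.nodup_append] at hl
    rw [List.map_append, List.map_singleton, isWeaklyRegular_append_iff,
      isWeaklyRegular_singleton_iff]
    refine ⟨ih hl.1, ?_⟩
    have ht : t ∉ l := fun h => hl.2.2 t h t (by simp) rfl
    have hI : (Ideal.ofList (l.map (X : σ → MvPolynomial σ F)) • ⊤ :
        Submodule (MvPolynomial σ F) (MvPolynomial σ F)) = Ideal.span (X '' {i | i ∈ l}) := by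
      rw [smul_eq_mul, Ideal.mul_top, Ideal.ofList]
      congr 1
      ext; simp
    rw [hI, isSMulRegular_quotient_iff_mem_of_smul_mem]
    intro f hf
    rw [smul_eq_mul, mem_ideal_span_X_image] at hf
    rw [mem_ideal_span_X_image]
    intro d hd
    obtain ⟨i, hi, hne⟩ := hf (Finsupp.single t 1 + d) (by
      rw [mem_support_iff, coeff_X_mul]; exact mem_support_iff.1 hd)
    refine ⟨i, hi, ?_⟩
    have : t ≠ i := by rintro rfl; exact ht hi
    simpa [Finsupp.single_apply, this] using hne

/-- Over a system of parameters of a polynomial ring, elements which are linearly independent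
modulo the parameters are independent over the subalgebra the parameters generate. -/
theorem MvPolynomial.aeval_eq_zero_of_sum_eq_zero {F σ κ : Type*} [Field F] [Infinite F] [Fintype σ]
    (p : σ → MvPolynomial σ F) (hp : ∀ i, constantCoeff (p i) = 0)
    (hX : ∀ i, ∃ N : ℕ, X i ^ N ∈ Ideal.span (Set.range p))
    (w : κ → MvPolynomial σ F) (s : Finset κ)
    (hw : ∀ a : κ → F, (∑ i ∈ s, a i • w i) ∈ Ideal.span (Set.range p) → ∀ i ∈ s, a i = 0)
    (a : κ → MvPolynomial σ F) (ha : ∑ i ∈ s, aeval p (a i) * w i = 0) :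
    ∀ i ∈ s, aeval p (a i) = 0 := by
  classical
  let R := MvPolynomial σ F
  let m : Ideal R := RingHom.ker (constantCoeff : R →+* F)
  have hm : m.IsMaximal := RingHom.ker_isMaximal_of_surjective _
    (fun x => ⟨C x, constantCoeff_C σ x⟩)
  let S := Localization.AtPrime m
  let π : R →+* S := algebraMap R S
  have hmem : ∀ x ∈ m, π x ∈ IsLocalRing.maximalIdeal S := fun x hx =>
    (IsLocalization.AtPrime.to_map_mem_maximal_iff S m x).2 hx
  let f : List S := ((Finset.univ : Finset σ).toList.map (X : σ → R)).map (algebraMap R S)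
  have hf : RingTheory.Sequence.IsWeaklyRegular S f :=
    (MvPolynomial.isWeaklyRegular_map_X _ (Finset.nodup_toList _)).of_isLocalization S m.primeCompl
  have hflen : f.length = Fintype.card σ := by simp [f]
  obtain ⟨c, hc, hreg⟩ := exists_linearIndependent_isWeaklyRegular (F := F) (fun i => π (p i))
    (fun i => hmem _ (hp i)) f hflen hf (by
      intro x hx
      simp only [f, List.map_map, List.mem_map, Finset.mem_toList, Finset.mem_univ, true_and] at hx
      obtain ⟨i, rfl⟩ := hx
      exact hmem _ (constantCoeff_X F i)) (by
      intro P hP hpP x hx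
      simp only [f, List.map_map, List.mem_map, Finset.mem_toList, Finset.mem_univ, true_and] at hx
      obtain ⟨i, rfl⟩ := hx
      obtain ⟨N, hN⟩ := hX i
      have h1 : Ideal.span (Set.range p) ≤ P.comap π := by
        rw [Ideal.span_le]
        rintro _ ⟨j, rfl⟩
        exact hpP j
      have h2 : π (X i ^ N) ∈ P := h1 hN
      rw [map_pow] at h2
      exact hP.mem_of_pow_mem N h2) (Fintype.card σ) hflen.ge
  rw [hflen, Nat.sub_self, List.take_zero, List.append_nil] at hreg
  set q : Fin (Fintype.card σ) → S := fun i => ∑ s, c i s • π (p s) with hq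
  have hspan : ∀ v : σ → F, ∃ d : Fin (Fintype.card σ) → F, ∑ j, d j • c j = v := by
    intro v
    have h1 : Submodule.span F (Set.range c) = ⊤ :=
      hc.span_eq_top_of_card_eq_finrank' (by simp)
    have h2 : v ∈ Submodule.span F (Set.range c) := by rw [h1]; trivial
    exact (Submodule.mem_span_range_iff_exists_fun F).1 h2
  choose d hd using fun s : σ => hspan (Pi.single s 1)
  have hpq : ∀ s, π (p s) = ∑ j, d s j • q j := by
    intro s
    have h3 : ∀ t, ∑ j, d s j * c j t = if t = s then 1 else 0 := by
      intro t
      have := congrFun (hd s) t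
      simpa [Finset.sum_apply, Pi.single_apply] using this
    simp only [hq, Finset.smul_sum, smul_smul]
    rw [Finset.sum_comm]
    simp only [← Finset.sum_smul, h3, ite_smul, one_smul, zero_smul]
    simp
  have hcomp : ∀ b : R, π (aeval p b) =
      aeval q (aeval (R := F)
        (fun s => ∑ j, d s j • (X j : MvPolynomial (Fin (Fintype.card σ)) F)) b) := by
    intro b
    have : ((IsScalarTower.toAlgHom F R S).comp (aeval p)) =
        (aeval q).comp (aeval (R := F)
          (fun s => ∑ j, d s j • (X j : MvPolynomial (Fin (Fintype.card σ)) F))) := by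
      apply MvPolynomial.algHom_ext
      intro i
      simpa using hpq i
    exact DFunLike.congr_fun this b
  have hinj : Function.Injective π :=
    IsLocalization.injective S m.primeCompl_le_nonZeroDivisors
  have hqp : Ideal.ofList (List.ofFn q) ≤ (Ideal.span (Set.range p)).map π := by
    rw [Ideal.ofList, Ideal.span_le]
    intro x hx
    simp only [List.mem_ofFn, Set.mem_ofPred_eq] at hx
    obtain ⟨j, rfl⟩ := hx
    refine Ideal.sum_mem _ fun s _ => ?_
    rw [Algebra.smul_def]
    exact Ideal.mul_mem_left _ _ (Ideal.mem_map_of_mem _ (Ideal.subset_span ⟨s, rfl⟩))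
  have hcontr : ∀ x : R, π x ∈ (Ideal.span (Set.range p)).map π → x ∈ Ideal.span (Set.range p) := by
    intro x hx
    obtain ⟨u, hu, hux⟩ :=
      (IsLocalization.algebraMap_mem_map_algebraMap_iff m.primeCompl S _ _).1 hx
    have hrad : m ≤ (Ideal.span (Set.range p)).radical := by
      have hmX : m ≤ Ideal.span (X '' Set.univ) := by
        intro y hy
        rw [mem_ideal_span_X_image]
        intro e he
        by_contra! hcon
        have he0 : e = 0 := Finsupp.ext fun i => hcon i trivial
        rw [he0, mem_support_iff] at he
        exact he hy
      refine hmX.trans (Ideal.span_le.2 ?_)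
      rintro _ ⟨i, -, rfl⟩
      exact hX i
    have hu' : constantCoeff u ≠ 0 := hu
    have h1 : C (constantCoeff u) - u ∈ m := by
      change constantCoeff _ = 0
      rw [map_sub, constantCoeff_C, sub_self]
    obtain ⟨N, hN⟩ := hrad h1
    have hdvd : C (constantCoeff u) - (C (constantCoeff u) - u) ∣
      C (constantCoeff u) ^ N - (C (constantCoeff u) - u) ^ N := sub_dvd_pow_sub_pow _ _ N
    rw [sub_sub_cancel] at hdvd
    obtain ⟨v, hv⟩ := hdvd
    have h2 : C (constantCoeff u) ^ N * x ∈ Ideal.span (Set.range p) := by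
      have : C (constantCoeff u) ^ N * x = v * (u * x) + x * (C (constantCoeff u) - u) ^ N := by
        linear_combination x * hv
      rw [this]
      exact Ideal.add_mem _ (Ideal.mul_mem_left _ _ hux) (Ideal.mul_mem_left _ _ hN)
    have h3 := Ideal.mul_mem_left _ (C ((constantCoeff u)⁻¹ ^ N)) h2
    rwa [← mul_assoc, ← C_pow, ← C_mul, ← mul_pow, inv_mul_cancel₀ hu', one_pow, C_1, one_mul] at h3
  have key := hreg.eq_zero_of_sum_aeval_smul_eq_zero (F := F) (R := S) q (fun i => π (w i)) s ?_
    (fun i => aeval (R := F)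
      (fun s => ∑ j, d s j • (X j : MvPolynomial (Fin (Fintype.card σ)) F)) (a i)) ?_
  · intro i hi
    apply hinj
    rw [hcomp, key i hi, map_zero, map_zero]
  · intro b hb
    refine hw b (hcontr _ ?_)
    refine hqp ?_
    rw [smul_eq_mul, Ideal.mul_top] at hb
    convert hb
    rw [map_sum]
    refine Finset.sum_congr rfl fun i _ => ?_
    rw [Algebra.smul_def, map_mul, smul_eq_mul, IsScalarTower.algebraMap_apply F R S]
  · simp_rw [← hcomp, smul_eq_mul, ← map_mul]
    rw [← map_sum, ha, map_zero]

theorem MvPolynomial.weightedHomogeneousComponent_mem_span {F σ M : Type*} [CommRing F]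
    [AddCommMonoid M] (w : σ → M) {ι : Type*} (p : ι → MvPolynomial σ F) (d : ι → M)
    (hp : ∀ i, IsWeightedHomogeneous w (p i) (d i)) {x : MvPolynomial σ F}
    (hx : x ∈ Ideal.span (Set.range p)) (n : M) :
    weightedHomogeneousComponent w n x ∈ Ideal.span (Set.range p) := by
  classical
  let : GradedAlgebra (weightedHomogeneousSubmodule F w) := weightedGradedAlgebra F w
  refine weightedHomogeneousComponent_mem_of_mem F w (Ideal.homogeneous_span _ _ ?_) hx n
  rintro _ ⟨i, rfl⟩
  exact ⟨d i, hp i⟩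

theorem Subalgebra.isIntegral_of_subset_span {F R : Type*} [CommRing F] [CommRing R] [Algebra F R]
    {A B : Subalgebra F R} (hAB : A ≤ B) (T : Finset R) (hT : (T : Set R) ⊆ B)
    (hspan : ∀ f ∈ B, f ∈ Submodule.span A (T : Set R)) {x : R} (hx : IsIntegral B x) :
    IsIntegral A x := by
  let B' : Subalgebra A R :=
    { B.toSubsemiring with
      algebraMap_mem' := fun r => hAB r.2 }
  have hfg : (Subalgebra.toSubmodule B').FG := by
    refine ⟨T, le_antisymm ?_ ?_⟩
    · rw [Submodule.span_le]; exact hT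
    · exact fun f hf => hspan f hf
  have : Module.Finite A B' := Module.Finite.iff_fg.2 hfg
  have : Algebra.IsIntegral A B' := Algebra.IsIntegral.of_finite A B'
  exact isIntegral_trans (A := B') x hx

theorem actVk_actVk {k : ℕ} (g h : Matrix (Fin k) (Fin k) ℂ) (f : MvPolynomial (Fin k) ℂ) :
    actVk g (actVk h f) = actVk (h * g) f := by
  have : (actVk g).comp (actVk h) = actVk (h * g) := by
    apply MvPolynomial.algHom_ext
    intro i
    simp only [actVk, AlgHom.comp_apply, aeval_X, map_sum, map_smul, Matrix.mul_apply,
      Finset.sum_smul, Finset.smul_sum, smul_smul]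
    rw [Finset.sum_comm]
  exact DFunLike.congr_fun this f

theorem actVk_one {k : ℕ} (f : MvPolynomial (Fin k) ℂ) : actVk 1 f = f := by
  have : actVk (1 : Matrix (Fin k) (Fin k) ℂ) = AlgHom.id ℂ _ := by
    apply MvPolynomial.algHom_ext
    intro i
    simp [actVk, Matrix.one_apply, ite_smul]
  rw [this, AlgHom.id_apply]

/-- The left action of a matrix group on `ℂ[V]` given by substituting inverses. -/
abbrev mulSemiringActionVk {k : ℕ} (G : Subgroup (GL (Fin k) ℂ)) :
    MulSemiringAction G (MvPolynomial (Fin k) ℂ) where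
  smul g f := actVk ((g⁻¹ : G) : GL (Fin k) ℂ).1 f
  one_smul f := by
    change actVk ((1⁻¹ : G) : GL (Fin k) ℂ).1 f = f
    rw [inv_one]
    exact actVk_one f
  mul_smul g h f := by
    change actVk (((g * h)⁻¹ : G) : GL (Fin k) ℂ).1 f = actVk _ (actVk _ f)
    rw [actVk_actVk, mul_inv_rev]
    rfl
  smul_zero g := map_zero (actVk _)
  smul_add g := map_add (actVk _)
  smul_one g := map_one (actVk _)
  smul_mul g := map_mul (actVk _)

/-- A homogeneous system of parameters of the invariant ring is one of the polynomial ring. -/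
theorem exists_X_pow_mem_span {k : ℕ} (G : Subgroup (GL (Fin k) ℂ)) (hGfin : Finite G)
    (p : Fin k → MvPolynomial (Fin k) ℂ) (dp : Fin k → ℕ)
    (hdp : ∀ i, 0 < dp i) (hphom : ∀ i, (p i).IsHomogeneous (dp i))
    (hpinv : ∀ i, p i ∈ invV k G)
    (hhsop : ∃ T : Finset (MvPolynomial (Fin k) ℂ),
      (↑T : Set (MvPolynomial (Fin k) ℂ)) ⊆ (invV k G : Set (MvPolynomial (Fin k) ℂ)) ∧
      ∀ f ∈ invV k G,
        f ∈ Submodule.span (Algebra.adjoin ℂ (Set.range p))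
              (↑T : Set (MvPolynomial (Fin k) ℂ))) (a : Fin k) :
    ∃ N : ℕ, X a ^ N ∈ Ideal.span (Set.range p) := by
  classical
  obtain ⟨T, hT, hspan⟩ := hhsop
  set A := Algebra.adjoin ℂ (Set.range p) with hA
  have hAinv : A ≤ invV k G := Algebra.adjoin_le (by rintro _ ⟨i, rfl⟩; exact hpinv i)
  let := mulSemiringActionVk G
  have hsmul : ∀ (g : G) (f : MvPolynomial (Fin k) ℂ),
    g • f = actVk ((g⁻¹ : G) : GL (Fin k) ℂ).1 f := fun _ _ => rfl
  have : Algebra.IsInvariant (invV k G) (MvPolynomial (Fin k) ℂ) G := ⟨fun b hb => by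
    refine ⟨⟨b, fun g hg => ?_⟩, rfl⟩
    have h1 := hb ⟨g, hg⟩⁻¹
    rw [hsmul, inv_inv] at h1
    exact h1⟩
  have hinteg : Algebra.IsIntegral (invV k G) (MvPolynomial (Fin k) ℂ) :=
    Algebra.IsInvariant.isIntegral (invV k G) _ G
  obtain ⟨h, hmonic, hroot⟩ : IsIntegral A (X a : MvPolynomial (Fin k) ℂ) :=
    Subalgebra.isIntegral_of_subset_span hAinv T hT hspan (hinteg.isIntegral _)
  let φ : A →+* ℂ := (constantCoeff : MvPolynomial (Fin k) ℂ →+* ℂ).comp A.val.toRingHom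
  let h' := h.map φ
  have hm' : h'.Monic := hmonic.map φ
  set J := Ideal.span (Set.range p) with hJ
  have hmk : ∀ x ∈ A, Ideal.Quotient.mk J (C (constantCoeff x)) = Ideal.Quotient.mk J x := by
    intro x hx
    induction hx using Algebra.adjoin_induction with
    | mem x hx =>
      obtain ⟨i, rfl⟩ := hx
      have h0 : constantCoeff (p i) = 0 := by
        rw [constantCoeff_eq]
        refine (hphom i).coeff_eq_zero ?_
        simpa using (hdp i).ne
      rw [h0, map_zero, map_zero, eq_comm, Ideal.Quotient.eq_zero_iff_mem]
      exact Ideal.subset_span ⟨i, rfl⟩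
    | algebraMap r => simp [algebraMap_eq]
    | add x y _ _ hx hy => simp only [map_add, hx, hy]
    | mul x y _ _ hx hy => simp only [map_mul, hx, hy]
  have hmem : h'.eval₂ C (X a) ∈ J := by
    rw [← Ideal.Quotient.eq_zero_iff_mem, Polynomial.eval₂_map, Polynomial.hom_eval₂]
    have h1 := congrArg (Ideal.Quotient.mk J) hroot
    rw [map_zero, Polynomial.hom_eval₂] at h1
    rw [← h1]
    congr 1
    ext x
    exact hmk x.1 x.2
  refine ⟨h'.natDegree, ?_⟩
  have h2 := MvPolynomial.weightedHomogeneousComponent_mem_span (1 : Fin k → ℕ) p dp hphom hmem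
    h'.natDegree
  convert h2
  rw [Polynomial.eval₂_eq_sum_range, map_sum, Finset.sum_range_succ, Finset.sum_eq_zero, zero_add]
  · rw [hm'.coeff_natDegree, C_1, one_mul]
    exact (IsWeightedHomogeneous.weightedHomogeneousComponent_same
      (isHomogeneous_X_pow a _)).symm
  · intro i hi
    refine IsWeightedHomogeneous.weightedHomogeneousComponent_ne (m := i) _ ?_
      (Finset.mem_range.1 hi).ne'
    exact IsWeightedHomogeneous.C_mul (isHomogeneous_X_pow a i) _

/-- The weight on the coordinates of `V^m` giving the multidegree. -/
def multiWeight (k m : ℕ) : Fin k × Fin m → Fin m → ℕ := fun x => Pi.single x.2 1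

theorem weight_multiWeight {k m : ℕ} (d : Fin k × Fin m →₀ ℕ) (j : Fin m) :
    Finsupp.weight (multiWeight k m) d j = ∑ a, d (a, j) := by
  rw [Finsupp.weight_apply, Finsupp.sum_fintype _ _ (by simp), Finset.sum_apply,
    Fintype.sum_prod_type]
  refine Finset.sum_congr rfl fun a _ => ?_
  simp [multiWeight, Pi.single_apply]

theorem isMultiHomog_iff {k m : ℕ} {f : PolyVkm k m} {α : Fin m → ℕ} :
    IsMultiHomog f α ↔ IsWeightedHomogeneous (multiWeight k m) f α := by
  simp only [IsMultiHomog, IsWeightedHomogeneous, mem_support_iff, funext_iff, weight_multiWeight]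

/-- The copies of the `p i` in the separate vector variables. -/
def vectorCopies {k : ℕ} (m : ℕ) (p : Fin k → MvPolynomial (Fin k) ℂ) (x : Fin k × Fin m) :
    PolyVkm k m :=
  rename (fun a => (a, x.2)) (p x.1)

theorem Pm_eq_range (k m : ℕ) (p : Fin k → MvPolynomial (Fin k) ℂ) :
    Pm k m p = (aeval (vectorCopies m p)).range := by
  rw [← Algebra.adjoin_range_eq_range_aeval, Pm]
  congr 1
  ext f
  simp [vectorCopies, eq_comm]

theorem isWeightedHomogeneous_vectorCopies {k m : ℕ} {p : Fin k → MvPolynomial (Fin k) ℂ}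
    {dp : Fin k → ℕ} (hphom : ∀ i, (p i).IsHomogeneous (dp i)) (x : Fin k × Fin m) :
    IsWeightedHomogeneous (multiWeight k m) (vectorCopies m p x) (Pi.single x.2 (dp x.1)) := by
  classical
  intro d hd
  obtain ⟨e, rfl, he⟩ := coeff_rename_ne_zero _ _ _ hd
  have h1 := hphom x.1 he
  rw [Finsupp.weight_apply, Finsupp.sum_fintype _ _ (by simp)] at h1
  rw [Finsupp.weight_apply, Finsupp.sum_mapDomain_index (by simp) (fun _ _ _ => add_smul _ _ _),
    Finsupp.sum_fintype _ _ (by simp), ← h1]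
  ext j
  simp [multiWeight, Finset.sum_apply, Pi.single_apply]

theorem constantCoeff_vectorCopies {k m : ℕ} {p : Fin k → MvPolynomial (Fin k) ℂ}
    {dp : Fin k → ℕ} (hdp : ∀ i, 0 < dp i) (hphom : ∀ i, (p i).IsHomogeneous (dp i))
    (x : Fin k × Fin m) : constantCoeff (vectorCopies m p x) = 0 := by
  rw [vectorCopies, constantCoeff_rename, constantCoeff_eq]
  refine (hphom _).coeff_eq_zero ?_
  simpa using (hdp _).ne

theorem exists_X_pow_mem_span_vectorCopies {k m : ℕ} {p : Fin k → MvPolynomial (Fin k) ℂ}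
    (hX : ∀ a, ∃ N : ℕ, X a ^ N ∈ Ideal.span (Set.range p)) (x : Fin k × Fin m) :
    ∃ N : ℕ, X x ^ N ∈ Ideal.span (Set.range (vectorCopies m p)) := by
  obtain ⟨N, hN⟩ := hX x.1
  refine ⟨N, ?_⟩
  let φ : MvPolynomial (Fin k) ℂ →ₐ[ℂ] PolyVkm k m := rename fun a => (a, x.2)
  have h1 := Ideal.mem_map_of_mem φ hN
  rw [Ideal.map_span, map_pow] at h1
  have h2 : φ (X x.1) = X x := by simp [φ]
  rw [h2] at h1
  refine Ideal.span_mono ?_ h1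
  rintro _ ⟨_, ⟨i, rfl⟩, rfl⟩
  exact ⟨(i, x.2), rfl⟩

theorem permActk_mul {k m : ℕ} (s t : Equiv.Perm (Fin m)) (f : PolyVkm k m) :
    permActk (s * t) f = permActk s (permActk t f) := by
  rw [permActk, permActk, permActk, rename_rename]
  rfl

theorem permActk_one {k m : ℕ} (f : PolyVkm k m) : permActk 1 f = f := by
  rw [permActk]
  exact rename_id_apply f

theorem permActk_vectorCopies {k m : ℕ} (p : Fin k → MvPolynomial (Fin k) ℂ)
    (s : Equiv.Perm (Fin m)) (x : Fin k × Fin m) :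
    permActk s (vectorCopies m p x) = vectorCopies m p (x.1, s x.2) := by
  rw [permActk, vectorCopies, rename_rename]
  rfl

theorem permActk_mem_span {k m : ℕ} {p : Fin k → MvPolynomial (Fin k) ℂ}
    (s : Equiv.Perm (Fin m)) {f : PolyVkm k m}
    (hf : f ∈ Ideal.span (Set.range (vectorCopies m p))) :
    permActk s f ∈ Ideal.span (Set.range (vectorCopies m p)) := by
  have h1 := Ideal.mem_map_of_mem (permActk s) hf
  rw [Ideal.map_span] at h1
  refine Ideal.span_mono ?_ h1
  rintro _ ⟨_, ⟨x, rfl⟩, rfl⟩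
  exact ⟨_, (permActk_vectorCopies p s x).symm⟩

theorem IsMultiHomog.permActk {k m : ℕ} {f : PolyVkm k m} {α : Fin m → ℕ}
    (hf : IsMultiHomog f α) (s : Equiv.Perm (Fin m)) :
    IsMultiHomog (permActk s f) (α ∘ s.symm) := by
  intro d hd j
  rw [mem_support_iff] at hd
  obtain ⟨e, rfl, he⟩ := coeff_rename_ne_zero _ _ _ hd
  have h1 := hf e (mem_support_iff.2 he) (s.symm j)
  rw [Function.comp_apply, ← h1]
  refine Finset.sum_congr rfl fun a _ => ?_
  have hinj : Function.Injective fun p : Fin k × Fin m => (p.1, s p.2) := by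
    rintro ⟨a, b⟩ ⟨c, d⟩ h
    simpa using h
  have := Finsupp.mapDomain_apply hinj e (a, s.symm j)
  simpa using this

theorem actVkm_permActk {k m : ℕ} (g : Matrix (Fin k) (Fin k) ℂ) (s : Equiv.Perm (Fin m))
    (f : PolyVkm k m) : actVkm g (permActk s f) = permActk s (actVkm g f) := by
  have : (actVkm g).comp (permActk s) = (permActk s).comp (actVkm (m := m) g) := by
    apply MvPolynomial.algHom_ext
    intro i
    simp [actVkm, permActk]
  exact DFunLike.congr_fun this f

theorem permActk_mem_invVm {k m : ℕ} {G : Subgroup (GL (Fin k) ℂ)} (s : Equiv.Perm (Fin m))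
    {f : PolyVkm k m} (hf : f ∈ invVm k m G) : permActk s f ∈ invVm k m G := by
  intro g hg
  rw [actVkm_permActk, hf g hg]

theorem actVkm_actVkm {k m : ℕ} (g h : Matrix (Fin k) (Fin k) ℂ) (f : PolyVkm k m) :
    actVkm g (actVkm h f) = actVkm (h * g) f := by
  have : (actVkm g).comp (actVkm h) = actVkm (m := m) (h * g) := by
    apply MvPolynomial.algHom_ext
    intro i
    simp only [actVkm, AlgHom.comp_apply, aeval_X, map_sum, map_smul, Matrix.mul_apply,
      Finset.sum_smul, Finset.smul_sum, smul_smul]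
    rw [Finset.sum_comm]
  exact DFunLike.congr_fun this f

theorem actVkm_rename {k m : ℕ} (g : Matrix (Fin k) (Fin k) ℂ) (j : Fin m)
    (f : MvPolynomial (Fin k) ℂ) :
    actVkm g (rename (fun a => (a, j)) f) = rename (fun a => (a, j)) (actVk g f) := by
  have : (actVkm g).comp (rename fun a => (a, j)) =
      (rename fun a => (a, j)).comp (actVk g) := by
    apply MvPolynomial.algHom_ext
    intro i
    simp [actVkm, actVk]
  exact DFunLike.congr_fun this f

theorem vectorCopies_mem_invVm {k m : ℕ} {G : Subgroup (GL (Fin k) ℂ)}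
    {p : Fin k → MvPolynomial (Fin k) ℂ} (hpinv : ∀ i, p i ∈ invV k G) (x : Fin k × Fin m) :
    vectorCopies m p x ∈ invVm k m G := by
  intro g hg
  rw [vectorCopies, actVkm_rename, hpinv _ g hg]

theorem isWeightedHomogeneous_actVkm {k m : ℕ} (g : Matrix (Fin k) (Fin k) ℂ) {f : PolyVkm k m}
    {α : Fin m → ℕ} (hf : IsWeightedHomogeneous (multiWeight k m) f α) :
    IsWeightedHomogeneous (multiWeight k m) (actVkm g f) α := by
  have hX (x : Fin k × Fin m) : IsWeightedHomogeneous (multiWeight k m)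
      (∑ b, g x.1 b • (X (b, x.2) : PolyVkm k m)) (multiWeight k m x) := by
    refine IsWeightedHomogeneous.sum _ _ _ fun b _ => ?_
    rw [smul_eq_C_mul]
    exact (isWeightedHomogeneous_X ℂ (multiWeight k m) (b, x.2)).C_mul _
  rw [actVkm, aeval_def, eval₂_eq]
  refine IsWeightedHomogeneous.sum _ _ _ fun d hd => ?_
  rw [algebraMap_eq]
  refine IsWeightedHomogeneous.C_mul ?_ _
  have h2 := hf (mem_support_iff.1 hd)
  rw [← h2, Finsupp.weight_apply, Finsupp.sum]
  exact IsWeightedHomogeneous.prod _ _ _ fun x _ => (hX x).pow _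

theorem sum_weightedHomogeneousComponent_of_support {k m : ℕ} (f : PolyVkm k m) :
    ∑ γ ∈ f.support.image (Finsupp.weight (multiWeight k m)),
      weightedHomogeneousComponent (multiWeight k m) γ f = f := by
  classical
  ext d
  rw [coeff_sum]
  simp only [coeff_weightedHomogeneousComponent]
  rw [Finset.sum_ite_eq]
  split_ifs with h
  · rfl
  · by_contra hne
    exact h (Finset.mem_image_of_mem _ (mem_support_iff.2 (Ne.symm hne)))

theorem weightedHomogeneousComponent_actVkm {k m : ℕ} (g : Matrix (Fin k) (Fin k) ℂ)
    (f : PolyVkm k m) (β : Fin m → ℕ) :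
    weightedHomogeneousComponent (multiWeight k m) β (actVkm g f) =
      actVkm g (weightedHomogeneousComponent (multiWeight k m) β f) := by
  classical
  have h (γ : Fin m → ℕ) :
      weightedHomogeneousComponent (multiWeight k m) β
        (actVkm g (weightedHomogeneousComponent (multiWeight k m) γ f)) =
      if γ = β then actVkm g (weightedHomogeneousComponent (multiWeight k m) γ f) else 0 := by
    have h1 := isWeightedHomogeneous_actVkm g
      (weightedHomogeneousComponent_isWeightedHomogeneous (w := multiWeight k m) γ f)
    split_ifs with h2
    · subst h2
      exact h1.weightedHomogeneousComponent_same
    · exact h1.weightedHomogeneousComponent_ne _ (Ne.symm h2)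
  conv_lhs => rw [← sum_weightedHomogeneousComponent_of_support f]
  simp only [map_sum, h]
  rw [Finset.sum_ite_eq']
  split_ifs with h2
  · rfl
  · rw [weightedHomogeneousComponent_eq_zero', map_zero]
    intro d hd hdβ
    exact h2 (Finset.mem_image.2 ⟨d, hd, hdβ⟩)

theorem weightedHomogeneousComponent_mem_invVm {k m : ℕ} {G : Subgroup (GL (Fin k) ℂ)}
    {f : PolyVkm k m} (hf : f ∈ invVm k m G) (β : Fin m → ℕ) :
    weightedHomogeneousComponent (multiWeight k m) β f ∈ invVm k m G := by
  intro g hg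
  rw [← weightedHomogeneousComponent_actVkm, hf g hg]

/-- Averaging: an invariant in the ideal generated by invariants has invariant coefficients. -/
theorem exists_sum_of_mem_invVm_of_mem_span {k m : ℕ} {G : Subgroup (GL (Fin k) ℂ)}
    (hGfin : Finite G) {ι : Type*} [Fintype ι] {q : ι → PolyVkm k m}
    (hq : ∀ i, q i ∈ invVm k m G) {f : PolyVkm k m} (hf : f ∈ invVm k m G)
    (hfq : f ∈ Ideal.span (Set.range q)) :
    ∃ r : ι → PolyVkm k m, (∀ i, r i ∈ invVm k m G) ∧ f = ∑ i, q i * r i := by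
  have := Fintype.ofFinite G
  obtain ⟨c, hc⟩ := Submodule.mem_span_range_iff_exists_fun _ |>.1 hfq
  refine ⟨fun i => (Fintype.card G : ℂ)⁻¹ • ∑ g : G, actVkm g.1.1 (c i), fun i => ?_, ?_⟩
  · intro h hh
    rw [map_smul, map_sum]
    congr 1
    refine Fintype.sum_equiv (Equiv.mulRight (⟨h, hh⟩ : G)) _ _ fun g => ?_
    rw [actVkm_actVkm]
    rfl
  · have h1 (g : G) : f = ∑ i, q i * actVkm g.1.1 (c i) := by
      conv_lhs => rw [← hf g.1 g.2, ← hc, map_sum]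
      refine Finset.sum_congr rfl fun i _ => ?_
      rw [smul_eq_mul, map_mul, hq i g.1 g.2, mul_comm]
    simp only [mul_smul_comm, ← Finset.smul_sum, Finset.mul_sum]
    rw [Finset.sum_comm, Finset.sum_congr rfl fun g _ => (h1 g).symm, Finset.sum_const,
      Finset.card_univ, ← Nat.cast_smul_eq_nsmul ℂ, smul_smul, inv_mul_cancel₀ (by simp), one_smul]

/-- Vectors whose images under arbitrary choices of finitely many linear maps stay independent. -/
theorem exists_linearIndependent_comp {F V V' H : Type*} [Field F] [Infinite F]
    [AddCommGroup V] [Module F V] [AddCommGroup V'] [Module F V'] [Finite H]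
    (τ : H → V →ₗ[F] V') (E : Submodule F V) (n : ℕ)
    (hn : ∀ h, n ≤ Module.finrank F (E.map (τ h))) :
    ∃ v : Fin n → V, (∀ i, v i ∈ E) ∧
      ∀ σ : Fin n → H, LinearIndependent F fun i => τ (σ i) (v i) := by
  induction n with
  | zero => exact ⟨Fin.elim0, fun i => i.elim0, fun σ => linearIndependent_empty_type⟩
  | succ n ih =>
    obtain ⟨v, hvE, hv⟩ := ih fun h => (Nat.le_succ n).trans (hn h)
    let U : ((Fin n → H) × H) → Submodule F E := fun y =>
      (Submodule.span F (Set.range fun i => τ (y.1 i) (v i))).comap (τ y.2 ∘ₗ E.subtype)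
    have hU : ⋃ y, (U y : Set E) ≠ Set.univ := by
      intro h
      obtain ⟨y, hy⟩ := Subspace.exists_eq_top_of_iUnion_eq_univ h
      have hle : E.map (τ y.2) ≤ Submodule.span F (Set.range fun i => τ (y.1 i) (v i)) := by
        rintro _ ⟨e, he, rfl⟩
        have : (⟨e, he⟩ : E) ∈ U y := hy ▸ Submodule.mem_top
        exact this
      have : Module.Finite F (Submodule.span F (Set.range fun i => τ (y.1 i) (v i))) :=
        Module.Finite.span_of_finite F (Set.finite_range _)
      have h1 := (hn y.2).trans (Submodule.finrank_mono hle)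
      have h2 : Module.finrank F (Submodule.span F (Set.range fun i => τ (y.1 i) (v i))) ≤ n := by
        simpa [Set.finrank] using finrank_range_le_card (R := F) fun i => τ (y.1 i) (v i)
      omega
    obtain ⟨e, he⟩ := (Set.ne_univ_iff_exists_notMem _).1 hU
    simp only [Set.mem_iUnion, not_exists] at he
    refine ⟨Fin.cons e.1 v, Fin.cases e.2 hvE, fun σ => ?_⟩
    have : (fun i => τ (σ i) ((Fin.cons e.1 v : Fin (n + 1) → V) i)) =
        Fin.cons (τ (σ 0) e.1) fun i : Fin n => τ (σ i.succ) (v i) := by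
      ext i
      refine Fin.cases ?_ (fun j => ?_) i <;> simp
    rw [this, linearIndependent_finCons]
    exact ⟨hv _, he (fun i => σ i.succ, σ 0)⟩

theorem MvPolynomial.finite_quotient_of_X_pow_mem {F σ : Type*} [Field F] [Finite σ]
    (I : Ideal (MvPolynomial σ F)) (hX : ∀ i, ∃ N : ℕ, X i ^ N ∈ I) :
    Module.Finite F (MvPolynomial σ F ⧸ I) := by
  have : Algebra.IsIntegral F (MvPolynomial σ F ⧸ I) := by
    refine ⟨fun y => ?_⟩
    obtain ⟨f, rfl⟩ := Ideal.Quotient.mk_surjective y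
    induction f using MvPolynomial.induction_on with
    | C a => exact isIntegral_algebraMap (R := F) (x := a)
    | add f g hf hg => rw [map_add]; exact hf.add hg
    | mul_X f i hf =>
      rw [map_mul]
      refine hf.mul ?_
      obtain ⟨N, hN⟩ := hX i
      have h0 : Ideal.Quotient.mk I (X i) ^ N = 0 := by
        rw [← map_pow, Ideal.Quotient.eq_zero_iff_mem]
        exact hN
      refine ⟨Polynomial.X ^ N, Polynomial.monic_X_pow N, ?_⟩
      simp [h0]
  exact Algebra.IsIntegral.finite

/-- Multihomogeneous elements independent modulo the parameters are independent over `P(m)`. -/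
theorem linearIndependent_of_modulo_span {k m : ℕ} {p : Fin k → MvPolynomial (Fin k) ℂ}
    {dp : Fin k → ℕ} (hdp : ∀ i, 0 < dp i) (hphom : ∀ i, (p i).IsHomogeneous (dp i))
    (hX : ∀ x, ∃ N : ℕ, X x ^ N ∈ Ideal.span (Set.range (vectorCopies m p)))
    {κ : Type*} (u : κ → PolyVkm k m) (deg : κ → Fin m → ℕ)
    (hdeg : ∀ x, IsWeightedHomogeneous (multiWeight k m) (u x) (deg x))
    (hli : ∀ (β : Fin m → ℕ) (s : Finset κ) (c : κ → ℂ), (∀ x ∈ s, deg x = β) →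
      ∑ x ∈ s, c x • u x ∈ Ideal.span (Set.range (vectorCopies m p)) → ∀ x ∈ s, c x = 0) :
    LinearIndependent (Pm k m p) u := by
  classical
  rw [linearIndependent_iff']
  intro s g hg x hx
  have hex (y : κ) : ∃ a : MvPolynomial (Fin k × Fin m) ℂ, aeval (vectorCopies m p) a = g y := by
    exact (Pm_eq_range k m p).le (g y).2
  choose a ha using hex
  apply Subtype.val_injective
  rw [← ha]
  refine aeval_eq_zero_of_sum_eq_zero (vectorCopies m p) (constantCoeff_vectorCopies hdp hphom)
    hX u s (fun c hc y hy => ?_) a ?_ x hx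
  · have h2 := weightedHomogeneousComponent_mem_span (multiWeight k m) (vectorCopies m p) _
      (isWeightedHomogeneous_vectorCopies hphom) hc (deg y)
    refine hli (deg y) {z ∈ s | deg z = deg y} c (by simp) ?_ y (by simp [hy])
    convert h2
    rw [map_sum, Finset.sum_filter]
    refine Finset.sum_congr rfl fun z _ => ?_
    rw [map_smul]
    split_ifs with h
    · rw [← h, (hdeg z).weightedHomogeneousComponent_same]
    · rw [(hdeg z).weightedHomogeneousComponent_ne _ (Ne.symm h), smul_zero]
  · rw [← hg]
    refine Finset.sum_congr rfl fun y _ => ?_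
    rw [ha]
    rfl

/-- Graded Nakayama lemma: invariants spanning modulo the parameters span over `P(m)`. -/
theorem mem_span_of_modulo_span {k m : ℕ} {G : Subgroup (GL (Fin k) ℂ)} (hGfin : Finite G)
    {p : Fin k → MvPolynomial (Fin k) ℂ} {dp : Fin k → ℕ} (hdp : ∀ i, 0 < dp i)
    (hphom : ∀ i, (p i).IsHomogeneous (dp i)) (hpinv : ∀ i, p i ∈ invV k G)
    (S : Set (PolyVkm k m)) (hS : S ⊆ invVm k m G)
    (hsp : ∀ (β : Fin m → ℕ), ∀ f ∈ invVm k m G, IsWeightedHomogeneous (multiWeight k m) f β →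
      ∃ h ∈ Submodule.span ℂ S, IsWeightedHomogeneous (multiWeight k m) h β ∧
        f - h ∈ Ideal.span (Set.range (vectorCopies m p))) (f : PolyVkm k m) :
    f ∈ invVm k m G ↔ f ∈ Submodule.span (Pm k m p) S := by
  classical
  set w := multiWeight k m
  have hPm : Pm k m p ≤ invVm k m G := by
    refine Algebra.adjoin_le ?_
    rintro _ ⟨i, j, rfl⟩
    exact vectorCopies_mem_invVm hpinv (i, j)
  have hSS : ∀ h ∈ Submodule.span ℂ S, h ∈ Submodule.span (Pm k m p) S := fun h hh =>
    Submodule.span_le_restrictScalars ℂ (Pm k m p) S hh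
  constructor
  · have key (n : ℕ) : ∀ (β : Fin m → ℕ), ∑ j, β j = n → ∀ f ∈ invVm k m G,
        IsWeightedHomogeneous w f β → f ∈ Submodule.span (Pm k m p) S := by
      induction n using Nat.strong_induction_on with
      | _ n ih =>
        intro β hβ f hf hfβ
        obtain ⟨h, hhS, hhβ, hI⟩ := hsp β f hf hfβ
        have hhW : h ∈ invVm k m G :=
          (Submodule.span_le (p := Subalgebra.toSubmodule (invVm k m G))).2 hS hhS
        obtain ⟨r, hr, hsum⟩ := exists_sum_of_mem_invVm_of_mem_span hGfin
          (vectorCopies_mem_invVm hpinv) (sub_mem hf hhW) hI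
        have hsub : f - h = ∑ x, weightedHomogeneousComponent w β (vectorCopies m p x * r x) := by
          rw [← map_sum, ← hsum]
          exact ((weightedHomogeneousSubmodule ℂ w β).sub_mem hfβ
            hhβ : IsWeightedHomogeneous w _ β).weightedHomogeneousComponent_same.symm
        rw [← sub_add_cancel f h, hsub]
        refine add_mem (sum_mem fun x _ => ?_) (hSS h hhS)
        rw [← sum_weightedHomogeneousComponent_of_support (r x), Finset.mul_sum, map_sum]
        refine sum_mem fun γ _ => ?_
        have hγ := weightedHomogeneousComponent_isWeightedHomogeneous (w := w) γ (r x)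
        have hmul := (isWeightedHomogeneous_vectorCopies hphom x).mul hγ
        by_cases hβγ : Pi.single x.2 (dp x.1) + γ = β
        · have h3 := hmul.weightedHomogeneousComponent_same
          rw [hβγ] at h3
          rw [h3]
          have hmem : vectorCopies m p x ∈ Pm k m p := Algebra.subset_adjoin ⟨x.1, x.2, rfl⟩
          refine Submodule.smul_mem _ (⟨_, hmem⟩ : Pm k m p) (ih (∑ j, γ j) ?_ γ rfl _
            (weightedHomogeneousComponent_mem_invVm (hr x) γ) hγ)
          rw [← hβ, ← hβγ]
          simp only [Pi.add_apply, Finset.sum_add_distrib, Finset.sum_pi_single', Finset.mem_univ,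
            if_true]
          have := hdp x.1
          omega
        · rw [hmul.weightedHomogeneousComponent_ne _ (Ne.symm hβγ)]
          exact zero_mem _
    intro hf
    rw [← sum_weightedHomogeneousComponent_of_support f]
    exact sum_mem fun γ _ => key _ γ rfl _ (weightedHomogeneousComponent_mem_invVm hf γ)
      (weightedHomogeneousComponent_isWeightedHomogeneous γ f)
  · intro hf
    induction hf using Submodule.span_induction with
    | mem x hx => exact hS hx
    | zero => exact zero_mem _
    | add x y _ _ hx hy => exact add_mem hx hy
    | smul a x _ hx => exact mul_mem (hPm a.2) hx

theorem exists_antitone_comp_symm_eq {m : ℕ} (β : Fin m → ℕ) :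
    ∃ (α : Fin m → ℕ) (t : Equiv.Perm (Fin m)), Antitone α ∧ α ∘ t.symm = β := by
  let t := Tuple.sort (OrderDual.toDual ∘ β)
  refine ⟨β ∘ t, t, fun i j hij => ?_, ?_⟩
  · exact Tuple.monotone_sort (OrderDual.toDual ∘ β) hij
  · ext j
    simp

theorem eq_of_antitone_of_comp_symm_eq {m : ℕ} {α α' : Fin m → ℕ} {s t : Equiv.Perm (Fin m)}
    (hα : Antitone α) (hα' : Antitone α') (h : α ∘ s.symm = α' ∘ t.symm) : α = α' := by
  have h1 : α' = α ∘ (t.trans s.symm) := by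
    ext j
    simpa using (congrFun h (t j)).symm
  have h2 := Tuple.unique_monotone (f := OrderDual.toDual ∘ α) (σ := Equiv.refl _)
    (τ := t.trans s.symm) (fun i j hij => hα hij) (fun i j hij => by
      have := hα' hij
      rw [h1] at this
      exact this)
  ext j
  rw [h1]
  exact congrArg OrderDual.ofDual (congrFun h2 j)

theorem mem_mStab_inv_mul_iff {m : ℕ} {α : Fin m → ℕ} {s t : Equiv.Perm (Fin m)} :
    s⁻¹ * t ∈ mStab α ↔ α ∘ s.symm = α ∘ t.symm := by
  constructor
  · intro h
    ext j
    simpa using h (t.symm j)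
  · intro h j
    simpa using congrFun h (t j)

/-- The multihomogeneous invariants of multidegree `α`. -/
def invComponent (k m : ℕ) (G : Subgroup (GL (Fin k) ℂ)) (α : Fin m → ℕ) :
    Submodule ℂ (PolyVkm k m) :=
  Subalgebra.toSubmodule (invVm k m G) ⊓ weightedHomogeneousSubmodule ℂ (multiWeight k m) α

theorem permActk_mem_invComponent {k m : ℕ} {G : Subgroup (GL (Fin k) ℂ)} {α : Fin m → ℕ}
    (s : Equiv.Perm (Fin m)) {f : PolyVkm k m} (hf : f ∈ invComponent k m G α) :
    permActk s f ∈ invComponent k m G (α ∘ s.symm) :=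
  ⟨permActk_mem_invVm s hf.1, isMultiHomog_iff.1 ((isMultiHomog_iff.2 hf.2).permActk s)⟩

theorem map_permActk_invComponent {k m : ℕ} {G : Subgroup (GL (Fin k) ℂ)} (α : Fin m → ℕ)
    (s : Equiv.Perm (Fin m)) :
    (invComponent k m G α).map (permActk s).toLinearMap = invComponent k m G (α ∘ s.symm) := by
  apply le_antisymm
  · rintro _ ⟨f, hf, rfl⟩
    exact permActk_mem_invComponent s hf
  · intro f hf
    refine ⟨permActk s⁻¹ f, ?_, ?_⟩
    · have h2 : (α ∘ s.symm) ∘ (s⁻¹).symm = α := by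
        ext j
        exact congrArg α (s.symm_apply_apply j)
      exact h2 ▸ permActk_mem_invComponent s⁻¹ hf
    · rw [AlgHom.toLinearMap_apply, ← permActk_mul, mul_inv_cancel, permActk_one]

/-- The projection of `ℂ[V^m]` modulo the ideal generated by the copies of the `p i`. -/
def quotCopies {k : ℕ} (m : ℕ) (p : Fin k → MvPolynomial (Fin k) ℂ) :
    PolyVkm k m →ₗ[ℂ] PolyVkm k m ⧸ Ideal.span (Set.range (vectorCopies m p)) :=
  (Ideal.Quotient.mkₐ ℂ _).toLinearMap

theorem quotCopies_eq_zero_iff {k m : ℕ} {p : Fin k → MvPolynomial (Fin k) ℂ}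
    {f : PolyVkm k m} :
    quotCopies m p f = 0 ↔ f ∈ Ideal.span (Set.range (vectorCopies m p)) :=
  Ideal.Quotient.eq_zero_iff_mem

theorem finrank_map_invComponent_comp_le {k m : ℕ} {G : Subgroup (GL (Fin k) ℂ)}
    {p : Fin k → MvPolynomial (Fin k) ℂ}
    [Module.Finite ℂ (PolyVkm k m ⧸ Ideal.span (Set.range (vectorCopies m p)))]
    (α : Fin m → ℕ) (s : Equiv.Perm (Fin m)) :
    Module.finrank ℂ ((invComponent k m G (α ∘ s.symm)).map (quotCopies m p)) ≤
      Module.finrank ℂ ((invComponent k m G α).map (quotCopies m p)) := by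
  let T := Ideal.Quotient.liftₐ (Ideal.span (Set.range (vectorCopies m p)))
    ((Ideal.Quotient.mkₐ ℂ (Ideal.span (Set.range (vectorCopies m p)))).comp (permActk s))
    fun f hf => Ideal.Quotient.eq_zero_iff_mem.2 (permActk_mem_span s hf)
  have h : (invComponent k m G (α ∘ s.symm)).map (quotCopies m p) =
      ((invComponent k m G α).map (quotCopies m p)).map T.toLinearMap := by
    rw [← map_permActk_invComponent, ← Submodule.map_comp, ← Submodule.map_comp]
    rfl
  rw [h]
  exact Submodule.finrank_map_le _ _

theorem finrank_map_invComponent_comp {k m : ℕ} {G : Subgroup (GL (Fin k) ℂ)}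
    {p : Fin k → MvPolynomial (Fin k) ℂ}
    [Module.Finite ℂ (PolyVkm k m ⧸ Ideal.span (Set.range (vectorCopies m p)))]
    (α : Fin m → ℕ) (s : Equiv.Perm (Fin m)) :
    Module.finrank ℂ ((invComponent k m G (α ∘ s.symm)).map (quotCopies m p)) =
      Module.finrank ℂ ((invComponent k m G α).map (quotCopies m p)) := by
  refine le_antisymm (finrank_map_invComponent_comp_le α s) ?_
  have h := finrank_map_invComponent_comp_le (G := G) (p := p) (α ∘ s.symm) s.symm
  have h2 : (α ∘ s.symm) ∘ s.symm.symm = α := by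
    ext j
    simp
  rwa [h2] at h

theorem finite_finrank_map_invComponent_ne_zero {k m : ℕ} (G : Subgroup (GL (Fin k) ℂ))
    {p : Fin k → MvPolynomial (Fin k) ℂ} {dp : Fin k → ℕ}
    (hphom : ∀ i, (p i).IsHomogeneous (dp i))
    [Module.Finite ℂ (PolyVkm k m ⧸ Ideal.span (Set.range (vectorCopies m p)))] :
    {α | Module.finrank ℂ ((invComponent k m G α).map (quotCopies m p)) ≠ 0}.Finite := by
  set S := {α | Module.finrank ℂ ((invComponent k m G α).map (quotCopies m p)) ≠ 0}
  have hex (α : S) : ∃ f ∈ invComponent k m G α.1, quotCopies m p f ≠ 0 := by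
    by_contra! h
    apply α.2
    have hbot : (invComponent k m G α.1).map (quotCopies m p) = ⊥ := by
      rw [Submodule.eq_bot_iff]
      rintro _ ⟨f, hf, rfl⟩
      exact h f hf
    rw [hbot, finrank_bot]
  choose f hf hf0 using hex
  have hli : LinearIndependent ℂ fun α => quotCopies m p (f α) := by
    classical
    rw [linearIndependent_iff']
    intro s c hc α hα
    simp only [← map_smul, ← map_sum] at hc
    have h2 := weightedHomogeneousComponent_mem_span (multiWeight k m) (vectorCopies m p) _
      (isWeightedHomogeneous_vectorCopies hphom) (quotCopies_eq_zero_iff.1 hc) α.1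
    rw [map_sum, Finset.sum_eq_single_of_mem α hα, map_smul,
      (hf α).2.weightedHomogeneousComponent_same, ← quotCopies_eq_zero_iff, map_smul] at h2
    · exact (smul_eq_zero.1 h2).resolve_right (hf0 α)
    · intro γ _ hγ
      rw [map_smul, (hf γ).2.weightedHomogeneousComponent_ne _
        (fun h => hγ (Subtype.ext h).symm), smul_zero]
  have := hli.finite
  exact Set.toFinite S

/-- **Existence of a system of secondary S-generators.** If `G ⊆ GL(V)` is a finite
group and `p₁, …, p_k` is a homogeneous system of parameters of `ℂ[V]^G`, then there
is a finite set `L` of multihomogeneous invariants with weakly decreasing multidegrees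
such that for every choice of left coset representatives of the stabilizers of the
multidegrees, the translates `s·f` (`f ∈ L`, `s` a chosen representative) form a basis
of `ℂ[V^m]^G` as a free `P(m)`-module. -/
theorem exists_secondary_S_generators
    (k m : ℕ) (hk : 1 ≤ k) (hm : 1 ≤ m)
    (G : Subgroup (GL (Fin k) ℂ)) (hGfin : Finite G)
    (p : Fin k → MvPolynomial (Fin k) ℂ) (dp : Fin k → ℕ)
    (hdp : ∀ i, 0 < dp i) (hphom : ∀ i, (p i).IsHomogeneous (dp i))
    (hpinv : ∀ i, p i ∈ invV k G)
    (hpindep : AlgebraicIndependent ℂ p)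
    (hhsop : ∃ T : Finset (MvPolynomial (Fin k) ℂ),
      (↑T : Set (MvPolynomial (Fin k) ℂ)) ⊆ (invV k G : Set (MvPolynomial (Fin k) ℂ)) ∧
      ∀ f ∈ invV k G,
        f ∈ Submodule.span (Algebra.adjoin ℂ (Set.range p))
              (↑T : Set (MvPolynomial (Fin k) ℂ))) :
    ∃ (L : Finset (PolyVkm k m)) (mdg : PolyVkm k m → Fin m → ℕ),
      (∀ f ∈ L, f ∈ invVm k m G ∧ IsMultiHomog f (mdg f) ∧ Antitone (mdg f)) ∧
      ∀ C : PolyVkm k m → Set (Equiv.Perm (Fin m)),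
        (∀ f ∈ L, IsCosetReps (mdg f) (C f)) →
        (LinearIndependent (Pm k m p)
          (fun x : {fs : PolyVkm k m × Equiv.Perm (Fin m) // fs.1 ∈ L ∧ fs.2 ∈ C fs.1} =>
            permActk x.1.2 x.1.1) ∧
         ∀ f : PolyVkm k m, f ∈ invVm k m G ↔
           f ∈ Submodule.span (Pm k m p)
                 (Set.range
                   (fun x : {fs : PolyVkm k m × Equiv.Perm (Fin m) //
                       fs.1 ∈ L ∧ fs.2 ∈ C fs.1} =>
                     permActk x.1.2 x.1.1))) := by
  classical
  let D : (Fin m → ℕ) → ℕ := fun α =>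
    Module.finrank ℂ ((invComponent k m G α).map (quotCopies m p))
  have hX := exists_X_pow_mem_span_vectorCopies (m := m)
    (exists_X_pow_mem_span G hGfin p dp hdp hphom hpinv hhsop)
  have hfin : Module.Finite ℂ (PolyVkm k m ⧸ Ideal.span (Set.range (vectorCopies m p))) :=
    finite_quotient_of_X_pow_mem _ hX
  have hDcomp (α : Fin m → ℕ) (s : Equiv.Perm (Fin m)) : D (α ∘ s.symm) = D α :=
    finrank_map_invComponent_comp α s
  have hv (α : Fin m → ℕ) : ∃ v : Fin (D α) → PolyVkm k m, (∀ i, v i ∈ invComponent k m G α) ∧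
      ∀ σ : Fin (D α) → Equiv.Perm (Fin m),
        LinearIndependent ℂ fun i => quotCopies m p (permActk (σ i) (v i)) := by
    refine exists_linearIndependent_comp (H := Equiv.Perm (Fin m))
      (fun s => quotCopies m p ∘ₗ (permActk s).toLinearMap) (invComponent k m G α) (D α)
      fun s => ?_
    rw [Submodule.map_comp, map_permActk_invComponent]
    exact (hDcomp α s).ge
  choose v hvmem hvli using hv
  have hLfin : {f | ∃ α, Antitone α ∧ ∃ i, v α i = f}.Finite := by
    refine ((finite_finrank_map_invComponent_ne_zero G hphom).biUnion
      fun α _ => Set.finite_range (v α)).subset ?_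
    rintro _ ⟨α, -, i, rfl⟩
    exact Set.mem_biUnion (fun h => (h ▸ i).elim0 : D α ≠ 0) ⟨i, rfl⟩
  let mdg : PolyVkm k m → Fin m → ℕ := fun f => Classical.epsilon (IsMultiHomog f)
  have hmdg (α : Fin m → ℕ) (i : Fin (D α)) : mdg (v α i) = α := by
    have hα : IsMultiHomog (v α i) α := isMultiHomog_iff.2 (hvmem α i).2
    have h0 : v α i ≠ 0 := fun h => (hvli α fun _ => 1).ne_zero i (by rw [h, map_zero, map_zero])
    exact IsWeightedHomogeneous.inj_right h0
      (isMultiHomog_iff.1 (Classical.epsilon_spec ⟨α, hα⟩)) (hvmem α i).2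
  refine ⟨hLfin.toFinset, mdg, fun f hf => ?_, fun C hC => ?_⟩
  · obtain ⟨α, hα, i, rfl⟩ := hLfin.mem_toFinset.1 hf
    rw [hmdg]
    exact ⟨(hvmem α i).1, isMultiHomog_iff.2 (hvmem α i).2, hα⟩
  let κ := {fs : PolyVkm k m × Equiv.Perm (Fin m) // fs.1 ∈ hLfin.toFinset ∧ fs.2 ∈ C fs.1}
  let u : κ → PolyVkm k m := fun x => permActk x.1.2 x.1.1
  let deg : κ → Fin m → ℕ := fun x => mdg x.1.1 ∘ x.1.2.symm
  have hu (x : κ) : u x ∈ invComponent k m G (deg x) := by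
    obtain ⟨α, -, i, hi⟩ := hLfin.mem_toFinset.1 x.2.1
    refine permActk_mem_invComponent x.1.2 ?_
    rw [← hi, hmdg]
    exact hvmem α i
  have henum (β : Fin m → ℕ) : ∃ y : Fin (D β) → κ, (∀ i, deg (y i) = β) ∧
      (∀ x, deg x = β → ∃ i, y i = x) ∧
      LinearIndependent ℂ fun i => quotCopies m p (u (y i)) := by
    obtain ⟨α, t, hα, rfl⟩ := exists_antitone_comp_symm_eq β
    rw [hDcomp]
    have hmemL (i : Fin (D α)) : v α i ∈ hLfin.toFinset :=
      hLfin.mem_toFinset.2 ⟨α, hα, i, rfl⟩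
    choose s hs huniq using fun i => hC (v α i) (hmemL i) t
    refine ⟨fun i => ⟨(v α i, s i), hmemL i, (hs i).1⟩, fun i => ?_, fun x hx => ?_, hvli α s⟩
    · have h1 := mem_mStab_inv_mul_iff.1 (hs i).2
      rw [hmdg] at h1
      change mdg (v α i) ∘ (s i).symm = _
      rw [hmdg, h1]
    · obtain ⟨⟨f, r⟩, hf, hr⟩ := x
      obtain ⟨α', hα', i, rfl⟩ := hLfin.mem_toFinset.1 hf
      change mdg (v α' i) ∘ r.symm = _ at hx
      rw [hmdg] at hx
      obtain rfl := eq_of_antitone_of_comp_symm_eq hα' hα hx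
      refine ⟨i, Subtype.ext (Prod.ext rfl ?_)⟩
      refine (huniq i r ⟨hr, mem_mStab_inv_mul_iff.2 ?_⟩).symm
      rw [hmdg, hx]
  constructor
  · refine linearIndependent_of_modulo_span hdp hphom hX u deg (fun x => (hu x).2)
      fun β s c hs hc x hx => ?_
    obtain ⟨y, -, hy, hli⟩ := henum β
    have hinj : Function.Injective y := fun i j h => hli.injective (by simp only [h])
    have himage : s = ({i | y i ∈ s} : Finset (Fin (D β))).image y := by
      ext z
      simp only [Finset.mem_image, Finset.mem_filter, Finset.mem_univ, true_and]
      constructor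
      · intro hz
        obtain ⟨i, rfl⟩ := hy z (hs z hz)
        exact ⟨i, hz, rfl⟩
      · rintro ⟨i, hi, rfl⟩
        exact hi
    obtain ⟨i, rfl⟩ := hy x (hs x hx)
    rw [← quotCopies_eq_zero_iff, himage, Finset.sum_image hinj.injOn, map_sum] at hc
    simp only [map_smul] at hc
    exact linearIndependent_iff'.1 hli _ (fun i => c (y i)) hc i (by simpa using hx)
  · refine mem_span_of_modulo_span hGfin hdp hphom hpinv (Set.range u) ?_ fun β f hf hfβ => ?_
    · rintro _ ⟨x, rfl⟩
      exact (hu x).1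
    · obtain ⟨y, hdeg, -, hli⟩ := henum β
      have hle : Submodule.span ℂ (Set.range fun i => quotCopies m p (u (y i))) ≤
          (invComponent k m G β).map (quotCopies m p) := by
        rw [Submodule.span_le]
        rintro _ ⟨i, rfl⟩
        exact Submodule.mem_map_of_mem (hdeg i ▸ hu (y i))
      have heq := Submodule.eq_of_le_of_finrank_eq hle (by
        rw [finrank_span_eq_card hli, Fintype.card_fin])
      have hmem : quotCopies m p f ∈ (invComponent k m G β).map (quotCopies m p) :=
        Submodule.mem_map_of_mem ⟨hf, hfβ⟩
      rw [← heq] at hmem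
      obtain ⟨c, hc⟩ := Submodule.mem_span_range_iff_exists_fun ℂ |>.1 hmem
      refine ⟨∑ i, c i • u (y i), sum_mem fun i _ => Submodule.smul_mem _ _
        (Submodule.subset_span ⟨y i, rfl⟩), ?_, ?_⟩
      · exact (weightedHomogeneousSubmodule ℂ (multiWeight k m) β).sum_mem fun i _ =>
          Submodule.smul_mem _ _ (hdeg i ▸ (hu (y i)).2)
      · rw [← quotCopies_eq_zero_iff, map_sub, ← hc, map_sum]
        simp only [map_smul, sub_self]

end
end
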